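/- arXiv:2103.10854 — 3 statements merged into one kernel-verified Lean document; each statement's English description precedes it below -/
import Mathlib

section
/- If the Fenchel conjugates φ_1^*,…,φ_N^* are strictly convex, then the dual UMOT functional f ↦ −Σ_{i=1}^N ∫_{X_i} φ_i^*(−f_i) dμ_i − ε ∫_X ( exp((f^⊕ − c)/ε) − 1 ) dγ^⊗ is strictly concave on L^{∞,×}(X). -/
open MeasureTheory ENNReal Real Filter Topology

noncomputable section
namespace UMOT

/-- The Boltzmann–Shannon entropy integrand `x ↦ x log x − x + 1` (with value `⊤` on `(-∞,0)`). -/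
def klFun (x : ℝ) : ℝ≥0∞ := if x < 0 then ⊤ else ENNReal.ofReal (x * Real.log x - x + 1)

/-- The recession constant `φ'_∞ = lim_{x→∞} φ(x)/x` of an entropy function. -/
def recession (φ : ℝ → ℝ≥0∞) : ℝ≥0∞ :=
  Filter.limsup (fun x : ℝ => φ x / ENNReal.ofReal x) Filter.atTop

/-- The φ-divergence `D_φ(μ,ν) = ∫ φ(dμ/dν) dν + φ'_∞ μ^⊥(X)`. -/
def Dphi {Z : Type*} [MeasurableSpace Z] (φ : ℝ → ℝ≥0∞) (μ ν : Measure Z) : ℝ≥0∞ :=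
  ∫⁻ z, φ ((μ.rnDeriv ν z).toReal) ∂ν + recession φ * μ.singularPart ν Set.univ

/-- The Kullback–Leibler divergence, i.e. the φ-divergence for the Boltzmann–Shannon entropy. -/
def KL {Z : Type*} [MeasurableSpace Z] (μ ν : Measure Z) : ℝ≥0∞ := Dphi klFun μ ν

/-- An entropy function: nonnegative (by the codomain `ℝ≥0∞`), proper (since `φ 1 = 0`),
convex, lower semicontinuous, with `φ 1 = 0` and `φ = ⊤` on `(-∞,0)`. -/
structure IsEntropyFunction (φ : ℝ → ℝ≥0∞) : Prop where
  one_eq_zero : φ 1 = 0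
  top_of_neg : ∀ x : ℝ, x < 0 → φ x = ⊤
  lsc : LowerSemicontinuous φ
  convex : ∀ x y t : ℝ, 0 ≤ t → t ≤ 1 →
    φ (t * x + (1 - t) * y) ≤ ENNReal.ofReal t * φ x + ENNReal.ofReal (1 - t) * φ y

/-- Fenchel conjugate `φ^*(q) = sup_x (qx − φ(x))`, valued in the extended reals. -/
def fconj (φ : ℝ → ℝ≥0∞) (q : ℝ) : EReal :=
  ⨆ x : ℝ, ((q * x : ℝ) : EReal) - ((φ x : ℝ≥0∞) : EReal)

/-- The nonnegative part of an extended real number, as an element of `ℝ≥0∞`. -/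
def erealToENNReal (x : EReal) : ℝ≥0∞ := if x = ⊤ then ⊤ else ENNReal.ofReal x.toReal

/-- Integral of an extended-real-valued function (difference of the integrals of the
positive and negative parts). -/
def eInt {Z : Type*} [MeasurableSpace Z] (μ : Measure Z) (g : Z → EReal) : EReal :=
  ((∫⁻ z, erealToENNReal (g z) ∂μ : ℝ≥0∞) : EReal)
    - ((∫⁻ z, erealToENNReal (-(g z)) ∂μ : ℝ≥0∞) : EReal)

/-- `f^⊕(x) = Σ_i f_i(x_i)`. -/
def fOplus {N : ℕ} {X : Fin N → Type*} (f : ∀ i, X i → ℝ) (x : ∀ i, X i) : ℝ :=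
  ∑ i, f i (x i)

/-- Membership in `L^{∞,×}(X)`: each component is a bounded measurable function. -/
def BddMeasTuple {N : ℕ} {X : Fin N → Type*} [∀ i, MeasurableSpace (X i)]
    (f : ∀ i, X i → ℝ) : Prop :=
  ∀ i, Measurable (f i) ∧ ∃ M : ℝ, ∀ x, |f i x| ≤ M

/-- The dual UMOT functional
`f ↦ −Σ_i ∫ φ_i^*(−f_i) dμ_i − ε ∫ (exp((f^⊕ − c)/ε) − 1) dγ^⊗`. -/
def dualFun {N : ℕ} {X : Fin N → Type*} [∀ i, MeasurableSpace (X i)]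
    (c : (∀ i, X i) → ℝ) (ε : ℝ) (φ : Fin N → ℝ → ℝ≥0∞)
    (μ γ : ∀ i, Measure (X i)) (f : ∀ i, X i → ℝ) : EReal :=
  - (∑ i, eInt (μ i) (fun y => fconj (φ i) (-(f i y))))
    - (ε : EReal) * (((∫⁻ x, ENNReal.ofReal (Real.exp ((fOplus f x - c x) / ε))
          ∂(Measure.pi γ) : ℝ≥0∞) : EReal) - ((Measure.pi γ Set.univ : ℝ≥0∞) : EReal))

theorem fconj_ge {φ : ℝ → ℝ≥0∞} (h : φ 1 = 0) (q : ℝ) : (q : EReal) ≤ fconj φ q := by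
  refine le_trans ?_ (le_iSup _ (1 : ℝ))
  simp [h]

theorem measurable_fconj (φ : ℝ → ℝ≥0∞) : Measurable (fconj φ) := by
  apply LowerSemicontinuous.measurable
  refine lowerSemicontinuous_iSup fun x => ?_
  by_cases h : φ x = ⊤
  · simp only [h, EReal.coe_ennreal_top, EReal.sub_top]
    exact lowerSemicontinuous_const
  · lift φ x to NNReal using h with a
    have : (fun q : ℝ => ((q * x : ℝ) : EReal) - (((a : ℝ≥0∞)) : EReal))
        = fun q : ℝ => ((q * x - a : ℝ) : EReal) := by
      funext q
      rw [EReal.coe_sub]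
      rfl
    rw [this]
    refine Continuous.lowerSemicontinuous ?_
    exact continuous_coe_real_ereal.comp (by fun_prop)

theorem measurable_erealToENNReal : Measurable erealToENNReal :=
  Measurable.ite (measurableSet_singleton _) measurable_const
    measurable_ereal_toReal.ennreal_ofReal

theorem erealToENNReal_coe (x : ℝ) : erealToENNReal (x : EReal) = ENNReal.ofReal x := by
  simp [erealToENNReal]

theorem ae_ne_top_of_eInt_ne_top {Z : Type*} [MeasurableSpace Z] {μ : Measure Z}
    [IsFiniteMeasure μ] {g : Z → EReal} (hg : Measurable g) {M : ℝ}
    (hM : ∀ z, (M : EReal) ≤ g z) (h : eInt μ g ≠ ⊤) :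
    (∀ᵐ z ∂μ, g z ≠ ⊤) ∧ Integrable (fun z => (g z).toReal) μ := by
  have hneg : ∫⁻ z, erealToENNReal (-(g z)) ∂μ < ⊤ := by
    refine lt_of_le_of_lt (lintegral_mono (g := fun _ => ENNReal.ofReal (-M)) fun z => ?_) ?_
    · have hz := hM z
      generalize g z = y at hz
      induction y with
      | bot => simp at hz
      | top => simp [erealToENNReal]
      | coe y =>
        rw [← EReal.coe_neg, erealToENNReal_coe]
        have : M ≤ y := by exact_mod_cast hz
        exact ENNReal.ofReal_le_ofReal (by linarith)
    · rw [lintegral_const]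
      exact ENNReal.mul_lt_top ENNReal.ofReal_lt_top (measure_lt_top _ _)
  have hpos : ∫⁻ z, erealToENNReal (g z) ∂μ < ⊤ := by
    refine lt_top_iff_ne_top.2 fun h' => h ?_
    lift ∫⁻ z, erealToENNReal (-(g z)) ∂μ to NNReal using hneg.ne with b hb
    rw [eInt, h', ← hb]
    exact EReal.top_sub_coe b
  have hae : ∀ᵐ z ∂μ, g z ≠ ⊤ := by
    filter_upwards [ae_lt_top (measurable_erealToENNReal.comp hg) hpos.ne] with z hz h'
    simp [erealToENNReal, h'] at hz
  refine ⟨hae, (measurable_ereal_toReal.comp hg).aestronglyMeasurable, ?_⟩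
  refine lt_of_le_of_lt (lintegral_mono_ae
    (g := fun z => erealToENNReal (g z) + erealToENNReal (-(g z))) ?_) ?_
  · filter_upwards [hae] with z hz
    have hz' := hM z
    generalize g z = y at hz hz'
    induction y with
    | bot => simp at hz'
    | top => simp at hz
    | coe y =>
      rw [← EReal.coe_neg, erealToENNReal_coe, erealToENNReal_coe, EReal.toReal_coe,
        ← ofReal_norm, Real.norm_eq_abs]
      rcases abs_cases y with ⟨h1, _⟩ | ⟨h1, _⟩ <;> rw [h1]
      · exact le_self_add
      · exact le_add_self
  · rw [lintegral_add_left (f := fun z => erealToENNReal (g z)) (measurable_erealToENNReal.comp hg)]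
    exact ENNReal.add_lt_top.2 ⟨hpos, hneg⟩

theorem eInt_eq_integral {Z : Type*} [MeasurableSpace Z] {μ : Measure Z} {g : Z → EReal}
    (hbot : ∀ z, g z ≠ ⊥) (htop : ∀ᵐ z ∂μ, g z ≠ ⊤)
    (hint : Integrable (fun z => (g z).toReal) μ) :
    eInt μ g = ((∫ z, (g z).toReal ∂μ : ℝ) : EReal) := by
  have h1 : ∫⁻ z, erealToENNReal (g z) ∂μ = ∫⁻ z, ENNReal.ofReal (g z).toReal ∂μ := by
    refine lintegral_congr_ae ?_
    filter_upwards [htop] with z hz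
    simp [erealToENNReal, hz]
  have h2 : ∫⁻ z, erealToENNReal (-(g z)) ∂μ = ∫⁻ z, ENNReal.ofReal (-(g z).toReal) ∂μ := by
    refine lintegral_congr fun z => ?_
    simp [erealToENNReal, hbot z]
  have f1 := hint.lintegral_lt_top
  have f2 := hint.neg.lintegral_lt_top
  simp only [Pi.neg_apply] at f2
  rw [eInt, h1, h2, integral_eq_lintegral_pos_part_sub_lintegral_neg_part hint, EReal.coe_sub,
    EReal.coe_ennreal_toReal f1.ne, EReal.coe_ennreal_toReal f2.ne]

/-- If `w` lies a.e. below a convex combination of `u` and `v`, so does its integral, with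
strict inequality unless they agree a.e. -/
theorem integral_le_combo {Z : Type*} [MeasurableSpace Z] {μ : Measure Z} {u v w : Z → ℝ}
    (hu : Integrable u μ) (hv : Integrable v μ) (hw : Integrable w μ) {s : ℝ}
    (h : ∀ᵐ z ∂μ, w z ≤ s * u z + (1 - s) * v z) :
    ∫ z, w z ∂μ ≤ s * ∫ z, u z ∂μ + (1 - s) * ∫ z, v z ∂μ ∧
      (¬ (∀ᵐ z ∂μ, w z = s * u z + (1 - s) * v z) →
        ∫ z, w z ∂μ < s * ∫ z, u z ∂μ + (1 - s) * ∫ z, v z ∂μ) := by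
  have hi : Integrable (fun z => s * u z + (1 - s) * v z) μ :=
    (hu.const_mul s).add (hv.const_mul (1 - s))
  have he : ∫ z, (s * u z + (1 - s) * v z) ∂μ
      = s * ∫ z, u z ∂μ + (1 - s) * ∫ z, v z ∂μ := by
    rw [integral_add (hu.const_mul s) (hv.const_mul (1 - s)), integral_const_mul,
      integral_const_mul]
  have hle := integral_mono_ae hw hi h
  refine ⟨he ▸ hle, fun hne => he ▸ lt_of_le_of_ne hle fun heq => hne ?_⟩
  exact (integral_eq_iff_of_ae_le hw hi h).1 heq

theorem eInt_fconj_combo {Z : Type*} [MeasurableSpace Z] {μ : Measure Z} [IsFiniteMeasure μ]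
    {φ : ℝ → ℝ≥0∞} (h1 : φ 1 = 0)
    (hstrict : ∀ q r : ℝ, q ≠ r → fconj φ q ≠ ⊤ → fconj φ r ≠ ⊤ →
      ∀ s : ℝ, 0 < s → s < 1 →
        fconj φ (s * q + (1 - s) * r)
          < (s : EReal) * fconj φ q + ((1 - s : ℝ) : EReal) * fconj φ r)
    {f g : Z → ℝ} (hf : Measurable f) (hg : Measurable g)
    (hfb : ∃ M : ℝ, ∀ x, |f x| ≤ M) (hgb : ∃ M : ℝ, ∀ x, |g x| ≤ M)
    (hft : eInt μ (fun y => fconj φ (-(f y))) ≠ ⊤)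
    (hgt : eInt μ (fun y => fconj φ (-(g y))) ≠ ⊤) {s : ℝ} (hs0 : 0 < s) (hs1 : s < 1) :
    ∃ A B C : ℝ, eInt μ (fun y => fconj φ (-(f y))) = A ∧
      eInt μ (fun y => fconj φ (-(g y))) = B ∧
      eInt μ (fun y => fconj φ (-(s * f y + (1 - s) * g y))) = C ∧
      C ≤ s * A + (1 - s) * B ∧ (¬ f =ᵐ[μ] g → C < s * A + (1 - s) * B) := by
  obtain ⟨M, hM⟩ := hfb
  obtain ⟨K, hK⟩ := hgb
  have hbot : ∀ q, fconj φ q ≠ ⊥ := fun q h => by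
    have := fconj_ge h1 q
    rw [h] at this
    simp at this
  have hmf : Measurable fun y => fconj φ (-(f y)) := (measurable_fconj φ).comp hf.neg
  have hmg : Measurable fun y => fconj φ (-(g y)) := (measurable_fconj φ).comp hg.neg
  have hmm : Measurable fun y => fconj φ (-(s * f y + (1 - s) * g y)) :=
    (measurable_fconj φ).comp (by fun_prop)
  obtain ⟨haf, hif⟩ := ae_ne_top_of_eInt_ne_top hmf (M := -M) (fun z =>
    le_trans (by exact_mod_cast neg_le_neg (le_trans (le_abs_self _) (hM z))) (fconj_ge h1 _)) hft
  obtain ⟨hag, hig⟩ := ae_ne_top_of_eInt_ne_top hmg (M := -K) (fun z =>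
    le_trans (by exact_mod_cast neg_le_neg (le_trans (le_abs_self _) (hK z))) (fconj_ge h1 _)) hgt
  have key : ∀ q r : ℝ, fconj φ q ≠ ⊤ → fconj φ r ≠ ⊤ →
      fconj φ (s * q + (1 - s) * r) ≠ ⊤ ∧
      (fconj φ (s * q + (1 - s) * r)).toReal
        ≤ s * (fconj φ q).toReal + (1 - s) * (fconj φ r).toReal ∧
      (q ≠ r → (fconj φ (s * q + (1 - s) * r)).toReal
        < s * (fconj φ q).toReal + (1 - s) * (fconj φ r).toReal) := by
    intro q r hq hr
    by_cases hqr : q = r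
    · subst hqr
      have : s * q + (1 - s) * q = q := by ring
      rw [this]
      exact ⟨hq, by linarith, fun h => (h rfl).elim⟩
    · have h := hstrict q r hqr hq hr s hs0 hs1
      have hb := hbot (s * q + (1 - s) * r)
      have hbq := hbot q
      have hbr := hbot r
      have ht := (lt_of_lt_of_le h le_top).ne
      lift fconj φ q to ℝ using ⟨hq, hbq⟩ with a
      lift fconj φ r to ℝ using ⟨hr, hbr⟩ with b
      lift fconj φ (s * q + (1 - s) * r) to ℝ using ⟨ht, hb⟩ with c
      have h' : c < s * a + (1 - s) * b := by exact_mod_cast h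
      simp only [EReal.toReal_coe]
      exact ⟨by simp, h'.le, fun _ => h'⟩
  have e : ∀ y, -(s * f y + (1 - s) * g y) = s * (-(f y)) + (1 - s) * (-(g y)) :=
    fun y => by ring
  have ham : ∀ᵐ y ∂μ, fconj φ (-(s * f y + (1 - s) * g y)) ≠ ⊤ := by
    filter_upwards [haf, hag] with y h2 h3
    rw [e]
    exact (key _ _ h2 h3).1
  have hle : ∀ᵐ y ∂μ, (fconj φ (-(s * f y + (1 - s) * g y))).toReal
      ≤ s * (fconj φ (-(f y))).toReal + (1 - s) * (fconj φ (-(g y))).toReal := by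
    filter_upwards [haf, hag] with y h2 h3
    rw [e]
    exact (key _ _ h2 h3).2.1
  have him : Integrable (fun y => (fconj φ (-(s * f y + (1 - s) * g y))).toReal) μ := by
    have hL : Integrable (fun y => -(s * f y + (1 - s) * g y)) μ := by
      have a1 : Integrable f μ := Integrable.of_bound hf.aestronglyMeasurable M
        (Eventually.of_forall hM)
      have a2 : Integrable g μ := Integrable.of_bound hg.aestronglyMeasurable K
        (Eventually.of_forall hK)
      exact ((a1.const_mul s).add (a2.const_mul (1 - s))).neg
    refine integrable_of_le_of_le (measurable_ereal_toReal.comp hmm).aestronglyMeasurable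
      ?_ hle hL ((hif.const_mul s).add (hig.const_mul (1 - s)))
    filter_upwards [ham] with y hy
    exact EReal.toReal_le_toReal (fconj_ge h1 (-(s * f y + (1 - s) * g y)))
      (EReal.coe_ne_bot _) hy
  obtain ⟨r1, r2⟩ := integral_le_combo hif hig him hle
  refine ⟨_, _, _, eInt_eq_integral (fun _ => hbot _) haf hif,
    eInt_eq_integral (fun _ => hbot _) hag hig,
    eInt_eq_integral (fun _ => hbot _) ham him, r1, fun hne => r2 fun hae => hne ?_⟩
  filter_upwards [hae, haf, hag] with y hy h2 h3
  by_contra hfg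
  have := (key _ _ h2 h3).2.2 fun h => hfg (neg_injective h)
  rw [← e] at this
  exact this.ne hy

theorem lintegral_exp_combo {Z : Type*} [MeasurableSpace Z] {γ : Measure Z} [IsFiniteMeasure γ]
    {p q : Z → ℝ} (hp : Measurable p) (hq : Measurable q) {M K : ℝ}
    (hpM : ∀ x, p x ≤ M) (hqK : ∀ x, q x ≤ K) {s : ℝ} (hs0 : 0 < s) (hs1 : s < 1) :
    ∃ A B C : ℝ,
      ((∫⁻ x, ENNReal.ofReal (Real.exp (p x)) ∂γ : ℝ≥0∞) : EReal) = A ∧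
      ((∫⁻ x, ENNReal.ofReal (Real.exp (q x)) ∂γ : ℝ≥0∞) : EReal) = B ∧
      ((∫⁻ x, ENNReal.ofReal (Real.exp (s * p x + (1 - s) * q x)) ∂γ : ℝ≥0∞) : EReal) = C ∧
      C ≤ s * A + (1 - s) * B ∧ (¬ p =ᵐ[γ] q → C < s * A + (1 - s) * B) := by
  have main : ∀ {r : Z → ℝ} {L : ℝ}, Measurable r → (∀ x, r x ≤ L) →
      Integrable (fun x => Real.exp (r x)) γ ∧
      ((∫⁻ x, ENNReal.ofReal (Real.exp (r x)) ∂γ : ℝ≥0∞) : EReal)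
        = ((∫ x, Real.exp (r x) ∂γ : ℝ) : EReal) := by
    intro r L hr hL
    have hi : Integrable (fun x => Real.exp (r x)) γ :=
      Integrable.of_bound hr.exp.aestronglyMeasurable (Real.exp L)
        (Eventually.of_forall fun x => by
          rw [Real.norm_eq_abs, Real.abs_exp]
          exact Real.exp_le_exp.2 (hL x))
    refine ⟨hi, ?_⟩
    rw [← ofReal_integral_eq_lintegral_ofReal hi (Eventually.of_forall fun x => (exp_pos _).le),
      EReal.coe_ennreal_ofReal, max_eq_left (integral_nonneg fun x => (exp_pos _).le)]
  obtain ⟨ip, ep⟩ := main hp hpM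
  obtain ⟨iq, eq⟩ := main hq hqK
  obtain ⟨im, em⟩ := main (r := fun x => s * p x + (1 - s) * q x) (L := s * M + (1 - s) * K)
    (by fun_prop) (fun x => add_le_add (mul_le_mul_of_nonneg_left (hpM x) hs0.le)
      (mul_le_mul_of_nonneg_left (hqK x) (by linarith)))
  obtain ⟨r1, r2⟩ := integral_le_combo ip iq im (s := s) (Eventually.of_forall fun x =>
    convexOn_exp.2 (Set.mem_univ (p x)) (Set.mem_univ (q x)) hs0.le (by linarith) (by ring))
  refine ⟨_, _, _, ep, eq, em, r1, fun hne => r2 fun hae => hne ?_⟩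
  filter_upwards [hae] with x hx
  by_contra hpq
  exact (strictConvexOn_exp.2 (Set.mem_univ (p x)) (Set.mem_univ (q x)) hpq hs0
    (by linarith : 0 < 1 - s) (by ring)).ne hx

theorem recession_klFun : recession klFun = ⊤ := by
  refine Tendsto.limsup_eq ?_
  have h : Tendsto (fun x : ℝ => ENNReal.ofReal (Real.log x - 1)) atTop (𝓝 ⊤) :=
    ENNReal.tendsto_ofReal_nhds_top.2 (tendsto_atTop_add_const_right _ _ tendsto_log_atTop)
  refine tendsto_nhds_top_mono h ?_
  filter_upwards [eventually_gt_atTop (0 : ℝ)] with x hx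
  rw [klFun, if_neg hx.not_gt, ← ENNReal.ofReal_div_of_pos hx]
  refine ENNReal.ofReal_le_ofReal ?_
  rw [le_div_iff₀ hx]
  linarith

theorem absolutelyContinuous_of_KL_lt_top {Z : Type*} [MeasurableSpace Z] {μ ν : Measure Z}
    [IsFiniteMeasure μ] [IsFiniteMeasure ν] (h : KL μ ν < ⊤) : μ ≪ ν := by
  rw [← Measure.singularPart_eq_zero, ← Measure.measure_univ_eq_zero]
  by_contra h0
  rw [KL, Dphi, recession_klFun, ENNReal.top_mul h0, add_top] at h
  exact lt_irrefl _ h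

/-- If `∑ j, f j` and `∑ j, g j` agree a.e. and each `f j`, `g j` agree on a non-null set,
then `f i` and `g i` agree a.e. for each `i`. -/
theorem ae_eq_of_fOplus_ae_eq {N : ℕ} {X : Fin N → Type*} [∀ i, MeasurableSpace (X i)]
    (γ : ∀ i, Measure (X i)) [∀ i, IsFiniteMeasure (γ i)] {f g : ∀ i, X i → ℝ}
    (h : fOplus f =ᵐ[Measure.pi γ] fOplus g)
    (hpos : ∀ j, γ j {x | f j x = g j x} ≠ 0) (i : Fin N) : f i =ᵐ[γ i] g i := by
  classical
  by_contra hne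
  have hB : γ i {x | ¬ f i x = g i x} ≠ 0 := hne
  let S : ∀ j, Set (X j) := fun j => if j = i then {x | ¬ f j x = g j x} else {x | f j x = g j x}
  have hS : Measure.pi γ (Set.univ.pi S) ≠ 0 := by
    rw [Measure.pi_pi]
    refine Finset.prod_ne_zero_iff.2 fun j _ => ?_
    by_cases hj : j = i
    · subst hj
      simpa [S] using hB
    · simpa [S, hj] using hpos j
  refine hS (measure_mono_null (fun x hx => ?_) (show Measure.pi γ {x | ¬ fOplus f x = fOplus g x}
    = 0 from h))
  have hi : ¬ f i (x i) = g i (x i) := by simpa [S] using hx i (Set.mem_univ i)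
  have hj : ∀ j ∈ Finset.univ.erase i, f j (x j) = g j (x j) := fun j hj => by
    simpa [S, Finset.ne_of_mem_erase hj] using hx j (Set.mem_univ j)
  show ¬ ∑ j, f j (x j) = ∑ j, g j (x j)
  rw [← Finset.add_sum_erase _ _ (Finset.mem_univ i),
    ← Finset.add_sum_erase _ (fun j => g j (x j)) (Finset.mem_univ i), Finset.sum_congr rfl hj]
  exact fun h => hi (add_right_cancel h)

theorem eInt_ne_top_of_dualFun_ne_bot {N : ℕ} {X : Fin N → Type*} [∀ i, MeasurableSpace (X i)]
    {c : (∀ i, X i) → ℝ} {ε : ℝ} {φ : Fin N → ℝ → ℝ≥0∞} {μ γ : ∀ i, Measure (X i)}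
    {f : ∀ i, X i → ℝ} (hb : ∀ i, eInt (μ i) (fun y => fconj (φ i) (-(f i y))) ≠ ⊥)
    (h : dualFun c ε φ μ γ f ≠ ⊥) (i : Fin N) :
    eInt (μ i) (fun y => fconj (φ i) (-(f i y))) ≠ ⊤ := by
  intro ht
  apply h
  have : ∑ i, eInt (μ i) (fun y => fconj (φ i) (-(f i y))) = ⊤ := by
    rw [← Finset.add_sum_erase _ _ (Finset.mem_univ i), ht]
    refine EReal.top_add_of_ne_bot ?_
    exact Finset.sum_induction _ (fun x => x ≠ (⊥ : EReal))
      (fun a b ha hb => EReal.add_ne_bot_iff.2 ⟨ha, hb⟩) (by simp) (fun j _ => hb j)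
  rw [dualFun, this, EReal.neg_top, EReal.bot_sub]

theorem eInt_fconj_ne_bot {Z : Type*} [MeasurableSpace Z] {μ : Measure Z} [IsFiniteMeasure μ]
    {φ : ℝ → ℝ≥0∞} (h1 : φ 1 = 0) {f : Z → ℝ} (hf : Measurable f)
    (hfb : ∃ M : ℝ, ∀ x, |f x| ≤ M) : eInt μ (fun y => fconj φ (-(f y))) ≠ ⊥ := by
  obtain ⟨M, hM⟩ := hfb
  intro h
  have hM' : ∀ z, ((-M : ℝ) : EReal) ≤ fconj φ (-(f z)) := fun z =>
    le_trans (by exact_mod_cast neg_le_neg (le_trans (le_abs_self _) (hM z))) (fconj_ge h1 _)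
  obtain ⟨ha, hi⟩ := ae_ne_top_of_eInt_ne_top ((measurable_fconj φ).comp hf.neg) hM'
    (by rw [Function.comp_def]; simp only [Pi.neg_apply]; rw [h]; exact bot_ne_top)
  have hbot : ∀ z, fconj φ (-(f z)) ≠ ⊥ := fun z h' => by
    have := hM' z
    rw [h', le_bot_iff] at this
    exact EReal.coe_ne_bot _ this
  rw [eInt_eq_integral hbot ha hi] at h
  exact EReal.coe_ne_bot _ h

theorem dualFun_eq_coe {N : ℕ} {X : Fin N → Type*} [∀ i, MeasurableSpace (X i)]
    {c : (∀ i, X i) → ℝ} {ε : ℝ} {φ : Fin N → ℝ → ℝ≥0∞} {μ γ : ∀ i, Measure (X i)}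
    [∀ i, IsFiniteMeasure (γ i)] {f : ∀ i, X i → ℝ} {A : Fin N → ℝ} {E : ℝ}
    (hA : ∀ i, eInt (μ i) (fun y => fconj (φ i) (-(f i y))) = A i)
    (hE : ((∫⁻ x, ENNReal.ofReal (Real.exp ((fOplus f x - c x) / ε))
      ∂(Measure.pi γ) : ℝ≥0∞) : EReal) = E) :
    dualFun c ε φ μ γ f
      = ((-(∑ i, A i) - ε * (E - (Measure.pi γ Set.univ).toReal) : ℝ) : EReal) := by
  have hsum : ∑ i, (A i : EReal) = ((∑ i, A i : ℝ) : EReal) :=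
    (map_sum (⟨⟨Real.toEReal, rfl⟩, EReal.coe_add⟩ : ℝ →+ EReal) A Finset.univ).symm
  rw [dualFun, Finset.sum_congr rfl fun i _ => hA i, hE, hsum,
    ← EReal.coe_ennreal_toReal (measure_ne_top (Measure.pi γ) Set.univ)]
  simp only [EReal.coe_sub, EReal.coe_neg, EReal.coe_mul]

/-- Proposition 3.2, strict concavity: if all Fenchel conjugates
`φ_i^*` are strictly convex, then the dual UMOT functional is strictly concave on
`L^{∞,×}(X)`. -/
theorem dualFun_strictConcave
    {N : ℕ} {X : Fin N → Type*}
    [∀ i, TopologicalSpace (X i)] [∀ i, PolishSpace (X i)] [∀ i, CompactSpace (X i)]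
    [∀ i, Nonempty (X i)] [∀ i, MeasurableSpace (X i)] [∀ i, BorelSpace (X i)]
    (μ γ : ∀ i, Measure (X i)) [∀ i, IsFiniteMeasure (μ i)] [∀ i, IsFiniteMeasure (γ i)]
    (hsupp : ∀ i (U : Set (X i)), IsOpen U → U.Nonempty → 0 < μ i U)
    (hKL : KL (Measure.pi μ) (Measure.pi γ) < ⊤)
    (c : (∀ i, X i) → ℝ) (hc : Continuous c) (hc0 : ∀ x, 0 ≤ c x)
    (ε : ℝ) (hε : 0 < ε)
    (φ : Fin N → ℝ → ℝ≥0∞) (hφ : ∀ i, IsEntropyFunction (φ i))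
    (hstrict : ∀ i, ∀ q r : ℝ, q ≠ r → fconj (φ i) q ≠ ⊤ → fconj (φ i) r ≠ ⊤ →
      ∀ s : ℝ, 0 < s → s < 1 →
        fconj (φ i) (s * q + (1 - s) * r)
          < (s : EReal) * fconj (φ i) q + ((1 - s : ℝ) : EReal) * fconj (φ i) r) :
    ∀ f g : ∀ i, X i → ℝ, BddMeasTuple f → BddMeasTuple g →
      (∃ i, ¬ f i =ᵐ[γ i] g i) →
      dualFun c ε φ μ γ f ≠ ⊥ → dualFun c ε φ μ γ g ≠ ⊥ →
      ∀ s : ℝ, 0 < s → s < 1 →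
        (s : EReal) * dualFun c ε φ μ γ f + ((1 - s : ℝ) : EReal) * dualFun c ε φ μ γ g
          < dualFun c ε φ μ γ (fun i x => s * f i x + (1 - s) * g i x) := by
  intro f g hf hg hne hfb hgb s hs0 hs1
  have hone : ∀ i, φ i 1 = 0 := fun i => (hφ i).one_eq_zero
  choose A B C hA hB hC hle hlt using fun i => eInt_fconj_combo (μ := μ i) (hone i) (hstrict i)
    (hf i).1 (hg i).1 (hf i).2 (hg i).2
    (eInt_ne_top_of_dualFun_ne_bot
      (fun i => eInt_fconj_ne_bot (hone i) (hf i).1 (hf i).2) hfb i)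
    (eInt_ne_top_of_dualFun_ne_bot
      (fun i => eInt_fconj_ne_bot (hone i) (hg i).1 (hg i).2) hgb i) hs0 hs1
  have hmeas : ∀ {f : ∀ i, X i → ℝ}, BddMeasTuple f →
      Measurable fun x => (fOplus f x - c x) / ε := fun {f} hf => by
    have : Measurable (fOplus f) := by
      unfold fOplus
      exact Finset.measurable_sum _ fun i _ => (hf i).1.comp (measurable_pi_apply i)
    exact (this.sub hc.measurable).div_const ε
  have hbdd : ∀ {f : ∀ i, X i → ℝ}, BddMeasTuple f →
      ∃ M, ∀ x, (fOplus f x - c x) / ε ≤ M := fun {f} hf => by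
    choose M hM using fun i => (hf i).2
    refine ⟨(∑ i, M i) / ε, fun x => div_le_div_of_nonneg_right ?_ hε.le⟩
    have : fOplus f x ≤ ∑ i, M i :=
      Finset.sum_le_sum fun i _ => (le_abs_self _).trans (hM i (x i))
    linarith [hc0 x]
  obtain ⟨K, hK⟩ := hbdd hf
  obtain ⟨L, hL⟩ := hbdd hg
  obtain ⟨P, Q, R, hP, hQ, hR, hle', hlt'⟩ :=
    lintegral_exp_combo (γ := Measure.pi γ) (hmeas hf) (hmeas hg) hK hL hs0 hs1
  have hmix : ∀ x, s * ((fOplus f x - c x) / ε) + (1 - s) * ((fOplus g x - c x) / ε)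
      = (fOplus (fun i x => s * f i x + (1 - s) * g i x) x - c x) / ε := fun x => by
    simp only [fOplus, Finset.sum_add_distrib, ← Finset.mul_sum]
    ring
  simp only [hmix] at hR
  rw [dualFun_eq_coe hA hP, dualFun_eq_coe hB hQ, dualFun_eq_coe hC hR]
  have hsum : ∑ i, (s * A i + (1 - s) * B i) = s * ∑ i, A i + (1 - s) * ∑ i, B i := by
    simp only [Finset.sum_add_distrib, ← Finset.mul_sum]
  have hsle : ∑ i, C i ≤ s * ∑ i, A i + (1 - s) * ∑ i, B i :=
    hsum ▸ Finset.sum_le_sum fun i _ => hle i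
  have hdich : (∑ i, C i < s * ∑ i, A i + (1 - s) * ∑ i, B i) ∨
      R < s * P + (1 - s) * Q := by
    by_contra! hcon
    have hμeq : ∀ j, f j =ᵐ[μ j] g j := fun j => by
      by_contra hj
      exact (hsum ▸ Finset.sum_lt_sum (fun i _ => hle i) ⟨j, Finset.mem_univ j, hlt j hj⟩).not_ge
        hcon.1
    have hγeq : fOplus f =ᵐ[Measure.pi γ] fOplus g := by
      by_contra hj
      refine (hlt' fun hae => hj ?_).not_ge hcon.2
      filter_upwards [hae] with x hx
      have := (div_left_inj' hε.ne').1 hx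
      linarith
    have hac := absolutelyContinuous_of_KL_lt_top hKL
    obtain ⟨i, hi⟩ := hne
    refine hi (ae_eq_of_fOplus_ae_eq γ hγeq (fun j h0 => ?_) i)
    have h1 : Measure.pi γ (Function.eval j ⁻¹' {x | f j x = g j x}) = 0 :=
      Measure.pi_eval_preimage_null γ h0
    have h2 : Measure.pi μ (Function.eval j ⁻¹' {x | f j x = g j x}ᶜ) = 0 :=
      Measure.pi_eval_preimage_null μ (hμeq j)
    have h3 : Measure.pi μ Set.univ = 0 := by
      rw [← Set.union_compl_self (Function.eval j ⁻¹' {x | f j x = g j x})]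
      exact measure_union_null (hac h1) h2
    rw [Measure.pi_univ, Finset.prod_eq_zero_iff] at h3
    obtain ⟨k, -, hk⟩ := h3
    exact (hsupp k Set.univ isOpen_univ Set.univ_nonempty).ne' hk
  have hεle := mul_le_mul_of_nonneg_left hle' hε.le
  have hfin : s * (-(∑ i, A i) - ε * (P - (Measure.pi γ Set.univ).toReal))
      + (1 - s) * (-(∑ i, B i) - ε * (Q - (Measure.pi γ Set.univ).toReal))
      < -(∑ i, C i) - ε * (R - (Measure.pi γ Set.univ).toReal) := by
    rcases hdich with h | h
    · linarith
    · have := mul_lt_mul_of_pos_left h hε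
      linarith
  exact_mod_cast hfin

end UMOT
end
end

section
/- Let ε > 0 and μ_i ∈ M^+(X_i) with ln(σ_{μ_i}) ∈ L^∞(X_i,γ_i) for all i = 1,…,N. For the sequence (f^{(n)})_{n∈ℕ} ⊂ L^{∞,×}(X) generated by the cyclic Sinkhorn iterations, there exist real numbers λ^{(n)} = (λ_1^{(n)},…,λ_N^{(n)}) with Σ_{i=1}^N λ_i^{(n)} = 0 and a constant M > 0 such that ‖f_i^{(n)} + λ_i^{(n)}‖_{L^∞(X_i,γ_i)} < M for all i and n. -/
open MeasureTheory ENNReal Real Filter Topology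

noncomputable section
namespace UMOT

/-- The dual Sinkhorn functional
`D_ε^φ(f) = −Σ_i ∫ φ_i^*(−f_i) dμ_i − ε ∫ exp((f^⊕ − c)/ε) dγ^⊗`. -/
def Dfun {N : ℕ} {X : Fin N → Type*} [∀ i, MeasurableSpace (X i)]
    (c : (∀ i, X i) → ℝ) (ε : ℝ) (φ : Fin N → ℝ → ℝ≥0∞)
    (μ γ : ∀ i, Measure (X i)) (f : ∀ i, X i → ℝ) : EReal :=
  - (∑ i, eInt (μ i) (fun y => fconj (φ i) (-(f i y))))
    - (ε : EReal) * ((∫⁻ x, ENNReal.ofReal (Real.exp ((fOplus f x - c x) / ε))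
        ∂(Measure.pi γ) : ℝ≥0∞) : EReal)

/-- Reassemble a point of the product space from its `j`-th coordinate and the remaining
coordinates. -/
def glue {N : ℕ} {X : Fin N → Type*} (j : Fin N) (y : X j)
    (z : ∀ i : {i : Fin N // i ≠ j}, X i.1) (i : Fin N) : X i :=
  if h : i = j then cast (congrArg X h.symm) y else z ⟨i, h⟩

/-- The `j`-th `(c,ε)`-transform, where `σ` is the tuple of densities `σ_{μ_i} = dμ_i/dγ_i`. -/
def ctransform {N : ℕ} {X : Fin N → Type*} [∀ i, MeasurableSpace (X i)]
    (c : (∀ i, X i) → ℝ) (ε : ℝ) (σ : ∀ i, X i → ℝ) (γ : ∀ i, Measure (X i))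
    (f : ∀ i, X i → ℝ) (j : Fin N) (y : X j) : ℝ :=
  ε * Real.log (σ j y) -
    ε * Real.log (∫ z : ∀ i : {i : Fin N // i ≠ j}, X i.1,
      Real.exp (((∑ i : {i : Fin N // i ≠ j}, f i.1 (z i)) - c (glue j y z)) / ε)
        ∂(Measure.pi fun i : {i : Fin N // i ≠ j} => γ i.1))

/-- The objective of the anisotropic proximity operator, `q ↦ ε e^{(p−q)/ε} + φ^*(q)`. -/
def aproxObj (φ : ℝ → ℝ≥0∞) (ε p q : ℝ) : EReal :=
  ((ε * Real.exp ((p - q) / ε) : ℝ) : EReal) + fconj φ q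

/-- The anisotropic proximity operator `aprox_{φ^*}^ε(p)`: the minimizer of
`q ↦ ε e^{(p−q)/ε} + φ^*(q)` (for entropy functions the set of minimizers is a
singleton, so its infimum is the minimizer). -/
def aprox (φ : ℝ → ℝ≥0∞) (ε p : ℝ) : ℝ :=
  sInf {q : ℝ | ∀ r : ℝ, aproxObj φ ε p q ≤ aproxObj φ ε p r}

/-- The `j`-th Sinkhorn mapping `f^{(c,ε,φ,j)} = −aprox_{φ_j^*}^ε(−f^{(c,ε,j)})`. -/
def sinkMap {N : ℕ} {X : Fin N → Type*} [∀ i, MeasurableSpace (X i)]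
    (c : (∀ i, X i) → ℝ) (ε : ℝ) (σ : ∀ i, X i → ℝ) (γ : ∀ i, Measure (X i))
    (φ : Fin N → ℝ → ℝ≥0∞) (f : ∀ i, X i → ℝ) (j : Fin N) (y : X j) : ℝ :=
  - aprox (φ j) ε (- ctransform c ε σ γ f j y)

/-- The real-valued Fenchel conjugate; meaningful where `fconj φ` is finite. -/
def conjR (φ : ℝ → ℝ≥0∞) (q : ℝ) : ℝ := (fconj φ q).toReal

lemma fconj_le_coe_iff (φ : ℝ → ℝ≥0∞) (q b : ℝ) :
    fconj φ q ≤ (b : EReal) ↔ ∀ x, φ x ≠ ⊤ → q * x - (φ x).toReal ≤ b := by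
  unfold fconj
  rw [iSup_le_iff]
  refine forall_congr' fun x => ?_
  by_cases hx : φ x = ⊤
  · simp [hx]
  · lift φ x to NNReal using hx with v
    simp only [ne_eq, ENNReal.coe_ne_top, not_false_eq_true, ENNReal.coe_toReal, forall_true_left,
      EReal.coe_nnreal_eq_coe_real]
    rw [← EReal.coe_sub, EReal.coe_le_coe_iff]

lemma IsEntropyFunction.le_fconj {φ : ℝ → ℝ≥0∞} (hφ : IsEntropyFunction φ) (q : ℝ) :
    (q : EReal) ≤ fconj φ q := by
  have := le_iSup (fun x : ℝ => ((q * x : ℝ) : EReal) - ((φ x : ℝ≥0∞) : EReal)) 1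
  simpa [fconj, hφ.one_eq_zero] using this

lemma IsEntropyFunction.fconj_ne_bot {φ : ℝ → ℝ≥0∞} (hφ : IsEntropyFunction φ) (q : ℝ) :
    fconj φ q ≠ ⊥ :=
  ((EReal.bot_lt_coe q).trans_le (hφ.le_fconj q)).ne'

lemma fconj_zero_le (φ : ℝ → ℝ≥0∞) : fconj φ 0 ≤ ((0 : ℝ) : EReal) :=
  (fconj_le_coe_iff φ 0 0).2 fun x _ => by simp

lemma IsEntropyFunction.coe_conjR {φ : ℝ → ℝ≥0∞} (hφ : IsEntropyFunction φ) {q : ℝ}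
    (hq : fconj φ q ≠ ⊤) : (conjR φ q : EReal) = fconj φ q :=
  EReal.coe_toReal hq (hφ.fconj_ne_bot q)

lemma IsEntropyFunction.sub_le_conjR {φ : ℝ → ℝ≥0∞} (hφ : IsEntropyFunction φ) {q : ℝ}
    (hq : fconj φ q ≠ ⊤) {x : ℝ} (hx : φ x ≠ ⊤) : q * x - (φ x).toReal ≤ conjR φ q :=
  (fconj_le_coe_iff φ q _).1 (hφ.coe_conjR hq).ge x hx

lemma IsEntropyFunction.conjR_le {φ : ℝ → ℝ≥0∞} (hφ : IsEntropyFunction φ) {q b : ℝ}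
    (h : ∀ x, φ x ≠ ⊤ → q * x - (φ x).toReal ≤ b) : fconj φ q ≠ ⊤ ∧ conjR φ q ≤ b := by
  have h1 := (fconj_le_coe_iff φ q b).2 h
  have h2 : fconj φ q ≠ ⊤ := (h1.trans_lt (EReal.coe_lt_top b)).ne
  refine ⟨h2, ?_⟩
  rw [← hφ.coe_conjR h2] at h1
  exact_mod_cast h1

lemma lowerSemicontinuous_fconj (φ : ℝ → ℝ≥0∞) : LowerSemicontinuous (fconj φ) := by
  refine lowerSemicontinuous_iSup fun x => ?_
  by_cases hx : φ x = ⊤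
  · simpa [hx] using lowerSemicontinuous_const
  · lift φ x to NNReal using hx with v
    simp only [EReal.coe_nnreal_eq_coe_real, ← EReal.coe_sub]
    exact (continuous_coe_real_ereal.comp (by fun_prop)).lowerSemicontinuous

lemma measurable_conjR (φ : ℝ → ℝ≥0∞) : Measurable (conjR φ) :=
  (lowerSemicontinuous_fconj φ).measurable.ereal_toReal

/-- Exchange inequality expressing convexity of the Fenchel conjugate. -/
lemma IsEntropyFunction.conjR_exchange {φ : ℝ → ℝ≥0∞} (hφ : IsEntropyFunction φ) {q q' δ : ℝ}
    (hq : fconj φ q ≠ ⊤) (hq' : fconj φ q' ≠ ⊤) (h0 : 0 ≤ δ) (h1 : δ ≤ q - q') :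
    fconj φ (q - δ) ≠ ⊤ ∧ fconj φ (q' + δ) ≠ ⊤ ∧
      conjR φ (q - δ) + conjR φ (q' + δ) ≤ conjR φ q + conjR φ q' := by
  have key : ∀ x y, φ x ≠ ⊤ → φ y ≠ ⊤ →
      ((q - δ) * x - (φ x).toReal) + ((q' + δ) * y - (φ y).toReal)
        ≤ conjR φ q + conjR φ q' := by
    intro x y hx hy
    rcases le_total y x with hxy | hxy
    · have e1 := hφ.sub_le_conjR hq hx
      have e2 := hφ.sub_le_conjR hq' hy
      nlinarith [mul_nonneg h0 (sub_nonneg.2 hxy)]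
    · have e1 := hφ.sub_le_conjR hq hy
      have e2 := hφ.sub_le_conjR hq' hx
      nlinarith [mul_nonneg (sub_nonneg.2 h1) (sub_nonneg.2 hxy)]
  have h11 : φ 1 ≠ ⊤ := by simp [hφ.one_eq_zero]
  have hA : fconj φ (q - δ) ≠ ⊤ :=
    (hφ.conjR_le (b := conjR φ q + conjR φ q' - ((q' + δ) * 1 - (φ 1).toReal))
      fun x hx => by linarith [key x 1 hx h11]).1
  have hB := hφ.conjR_le (q := q' + δ) (b := conjR φ q + conjR φ q' - conjR φ (q - δ))
    fun y hy => by
      have := (hφ.conjR_le (q := q - δ)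
        (b := conjR φ q + conjR φ q' - ((q' + δ) * y - (φ y).toReal))
        fun x hx => by linarith [key x y hx hy]).2
      linarith
  exact ⟨hA, hB.1, by linarith [hB.2]⟩

/-- `q` minimizes the objective of the anisotropic proximity operator at `p`. -/
def IsProx (φ : ℝ → ℝ≥0∞) (ε p q : ℝ) : Prop := ∀ r : ℝ, aproxObj φ ε p q ≤ aproxObj φ ε p r

lemma IsProx.fconj_ne_top {φ : ℝ → ℝ≥0∞} {ε p q : ℝ}
    (h : IsProx φ ε p q) : fconj φ q ≠ ⊤ := by
  intro hq
  have h0 := h 0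
  unfold aproxObj at h0
  rw [hq, EReal.coe_add_top, top_le_iff] at h0
  have h1 := (add_le_add_right (fconj_zero_le φ) ((ε * exp ((p - 0) / ε) : ℝ) : EReal))
  rw [h0, ← EReal.coe_add, top_le_iff] at h1
  exact EReal.coe_ne_top _ h1

lemma IsProx.le {φ : ℝ → ℝ≥0∞} (hφ : IsEntropyFunction φ) {ε p q : ℝ}
    (h : IsProx φ ε p q) {r : ℝ} (hr : fconj φ r ≠ ⊤) :
    ε * exp ((p - q) / ε) + conjR φ q ≤ ε * exp ((p - r) / ε) + conjR φ r := by
  have h1 := h r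
  unfold aproxObj at h1
  rw [← hφ.coe_conjR h.fconj_ne_top, ← hφ.coe_conjR hr] at h1
  exact_mod_cast h1

lemma IsProx.conjR_le {φ : ℝ → ℝ≥0∞} (hφ : IsEntropyFunction φ) {ε p q : ℝ} (hε : 0 < ε)
    (h : IsProx φ ε p q) : conjR φ q ≤ ε * exp (p / ε) := by
  have h0 := hφ.conjR_le (q := 0) (b := 0) (fun x _ => by simp)
  have := h.le hφ h0.1
  have h3 : 0 < ε * exp ((p - q) / ε) := by positivity
  rw [sub_zero] at this
  linarith [h0.2]

/-- The complementary part `p - q` of the proximity operator is monotone. -/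
lemma IsProx.sub_mono {φ : ℝ → ℝ≥0∞} (hφ : IsEntropyFunction φ) {ε p p' q q' : ℝ} (hε : 0 < ε)
    (h : IsProx φ ε p q) (h' : IsProx φ ε p' q') (hp : p' ≤ p) : p' - q' ≤ p - q := by
  by_contra! hlt
  set δ := ((p' - q') - (p - q)) / 2 with hδ
  have hδ0 : 0 < δ := by linarith
  obtain ⟨e1, e2, e3⟩ := hφ.conjR_exchange h.fconj_ne_top h'.fconj_ne_top hδ0.le (by linarith)
  have m1 := h.le hφ e1
  have m2 := h'.le hφ e2
  set u := exp ((p - q) / ε)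
  set v := exp ((p' - q') / ε)
  set w := exp ((p - q + δ) / ε) with hw
  have w1 : exp ((p - (q - δ)) / ε) = w := by rw [hw]; congr 2; ring
  have w2 : exp ((p' - (q' + δ)) / ε) = w := by
    rw [hw]; congr 2; rw [hδ]; ring
  have huw : u < w := exp_lt_exp.2 (by gcongr; linarith)
  have hprod : u * v = w * w := by
    rw [hw, ← exp_add, ← exp_add]; congr 1; rw [hδ]; field_simp; ring
  rw [w1] at m1
  rw [w2] at m2
  have h4 : u + v ≤ w + w := by
    have : ε * (u + v) ≤ ε * (w + w) := by linarith
    exact le_of_mul_le_mul_left this hε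
  have hu : 0 < u := exp_pos _
  nlinarith [mul_pos (sub_pos.2 huw) (sub_pos.2 huw)]

lemma IsProx.unique {φ : ℝ → ℝ≥0∞} (hφ : IsEntropyFunction φ) {ε p q q' : ℝ} (hε : 0 < ε)
    (h : IsProx φ ε p q) (h' : IsProx φ ε p q') : q = q' := by
  linarith [h.sub_mono hφ hε h' le_rfl, h'.sub_mono hφ hε h le_rfl]

/-- The proximity operator is monotone. -/
lemma IsProx.mono {φ : ℝ → ℝ≥0∞} (hφ : IsEntropyFunction φ) {ε p p' q q' : ℝ} (hε : 0 < ε)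
    (h : IsProx φ ε p q) (h' : IsProx φ ε p' q') (hp : p' ≤ p) : q' ≤ q := by
  rcases hp.eq_or_lt with rfl | hp
  · exact (h'.unique hφ hε h).le
  by_contra! hlt
  have m1 := h.le hφ h'.fconj_ne_top
  have m2 := h'.le hφ h.fconj_ne_top
  simp only [sub_div, exp_sub] at m1 m2
  have hP : exp (p' / ε) < exp (p / ε) := exp_lt_exp.2 (by gcongr)
  have hQ : (exp (q' / ε))⁻¹ < (exp (q / ε))⁻¹ := by
    rw [← exp_neg, ← exp_neg]
    exact exp_lt_exp.2 (by gcongr)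
  simp only [div_eq_mul_inv] at m1 m2 hP hQ
  have := mul_pos hε (mul_pos (sub_pos.2 hP) (sub_pos.2 hQ))
  nlinarith

lemma IsEntropyFunction.exists_isProx {φ : ℝ → ℝ≥0∞} (hφ : IsEntropyFunction φ) {ε : ℝ}
    (hε : 0 < ε) (p : ℝ) : ∃ q, IsProx φ ε p q := by
  have hlsc : LowerSemicontinuous (aproxObj φ ε p) := by
    refine LowerSemicontinuous.add' ?_ (lowerSemicontinuous_fconj φ) fun q => ?_
    · refine Continuous.lowerSemicontinuous ?_
      exact continuous_coe_real_ereal.comp (by fun_prop)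
    · exact EReal.continuousAt_add (Or.inl (EReal.coe_ne_top _)) (Or.inl (EReal.coe_ne_bot _))
  set b := ε * exp (p / ε) with hb
  have hb0 : 0 < b := by positivity
  set R := |p| + b + 2 * ε + 2 * (b + |p|) with hR
  have hR0 : 0 ≤ R := by positivity
  have hlow : ∀ q, aproxObj φ ε p q ≤ aproxObj φ ε p 0 → q ∈ Set.Icc (-R) R := by
    intro q hq
    have h1 : ((ε * exp ((p - q) / ε) + q : ℝ) : EReal) ≤ aproxObj φ ε p q := by
      rw [EReal.coe_add]
      exact add_le_add_right (hφ.le_fconj q) _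
    have h2 : aproxObj φ ε p 0 ≤ ((ε * exp ((p - 0) / ε) + 0 : ℝ) : EReal) := by
      rw [EReal.coe_add]
      exact add_le_add_right (fconj_zero_le φ) _
    have h3 : ε * exp ((p - q) / ε) + q ≤ b := by
      have := (h1.trans hq).trans h2
      rw [EReal.coe_le_coe_iff] at this
      simpa [hb] using this
    constructor
    · by_contra! hlt
      have ht : 0 ≤ (p - q) / ε := div_nonneg (by linarith [neg_abs_le p]) hε.le
      have h4 := quadratic_le_exp_of_nonneg ht
      set t := (p - q) / ε with htd
      have h5 : ε * t = p - q := by rw [htd]; field_simp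
      have h6 : ε * (1 + t + t ^ 2 / 2) ≤ ε * exp t := by gcongr
      have h7 : ε * t ≥ 2 * ε + 2 * (b + |p|) := by rw [h5]; linarith [neg_abs_le p]
      have h8 : 2 ≤ t := by
        by_contra! h
        nlinarith [abs_nonneg p]
      have h9 : ε * t ≤ ε * t ^ 2 / 2 := by nlinarith
      nlinarith [neg_abs_le p, abs_nonneg p]
    · have : 0 < ε * exp ((p - q) / ε) := by positivity
      linarith [abs_nonneg p]
  obtain ⟨q, -, hq⟩ := (hlsc.lowerSemicontinuousOn (Set.Icc (-R) R)).exists_isMinOn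
    ⟨0, by constructor <;> linarith⟩ isCompact_Icc
  refine ⟨q, fun r => ?_⟩
  have hq0 : aproxObj φ ε p q ≤ aproxObj φ ε p 0 := hq ⟨by linarith, by linarith⟩
  by_cases hr : r ∈ Set.Icc (-R) R
  · exact hq hr
  · exact hq0.trans (le_of_not_ge fun h => hr (hlow r h))

lemma IsEntropyFunction.isProx_aprox {φ : ℝ → ℝ≥0∞} (hφ : IsEntropyFunction φ) {ε : ℝ}
    (hε : 0 < ε) (p : ℝ) : IsProx φ ε p (aprox φ ε p) := by
  obtain ⟨q, hq⟩ := hφ.exists_isProx hε p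
  have : {q : ℝ | ∀ r : ℝ, aproxObj φ ε p q ≤ aproxObj φ ε p r} = {q} :=
    Set.Subset.antisymm (fun _ h => IsProx.unique hφ hε h hq) (by rintro _ rfl; exact hq)
  rw [aprox, this, csInf_singleton]
  exact hq

lemma IsEntropyFunction.aprox_mono {φ : ℝ → ℝ≥0∞} (hφ : IsEntropyFunction φ) {ε : ℝ}
    (hε : 0 < ε) : Monotone (aprox φ ε) := fun p p' h =>
  (hφ.isProx_aprox hε p').mono hφ hε (hφ.isProx_aprox hε p) h

lemma IsEntropyFunction.sub_aprox_mono {φ : ℝ → ℝ≥0∞} (hφ : IsEntropyFunction φ) {ε : ℝ}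
    (hε : 0 < ε) : Monotone (fun p => p - aprox φ ε p) := fun p p' h =>
  (hφ.isProx_aprox hε p').sub_mono hφ hε (hφ.isProx_aprox hε p) h

lemma IsEntropyFunction.abs_aprox_sub_le {φ : ℝ → ℝ≥0∞} (hφ : IsEntropyFunction φ) {ε : ℝ}
    (hε : 0 < ε) (p p' : ℝ) : |aprox φ ε p - aprox φ ε p'| ≤ |p - p'| := by
  rcases le_total p p' with h | h
  · have h1 := hφ.aprox_mono hε h
    have h2 := hφ.sub_aprox_mono hε h
    simp only at h2
    rw [abs_of_nonpos (by linarith), abs_of_nonpos (by linarith)]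
    linarith
  · have h1 := hφ.aprox_mono hε h
    have h2 := hφ.sub_aprox_mono hε h
    simp only at h2
    rw [abs_of_nonneg (by linarith), abs_of_nonneg (by linarith)]
    linarith

/-- If the domain of `φ` is bounded above, then so is `p - aprox p`. -/
lemma IsEntropyFunction.sub_aprox_le {φ : ℝ → ℝ≥0∞} (hφ : IsEntropyFunction φ) {ε : ℝ}
    (hε : 0 < ε) {s : ℝ} (hs : ∀ x, s < x → φ x = ⊤) : ∃ B, ∀ p, p - aprox φ ε p ≤ B := by
  set κ := 1 - exp (-1) with hκ
  have hκ0 : 0 < κ := by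
    have : exp (-1) < 1 := by simp
    linarith
  refine ⟨ε * (s / κ), fun p => ?_⟩
  set q := aprox φ ε p with hqd
  have hq : IsProx φ ε p q := hφ.isProx_aprox hε p
  have h1 := hφ.conjR_le (q := q + ε) (b := conjR φ q + ε * s) fun x hx => by
    have h2 := hφ.sub_le_conjR hq.fconj_ne_top hx
    have h3 : x ≤ s := by
      by_contra! h
      exact hx (hs x h)
    nlinarith
  have h4 := hq.le hφ h1.1
  have h5 : exp ((p - (q + ε)) / ε) = exp ((p - q) / ε) * exp (-1) := by
    rw [← exp_add]; congr 1; field_simp; ring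
  rw [h5] at h4
  have h6 : exp ((p - q) / ε) * κ ≤ s := by
    refine le_of_mul_le_mul_left ?_ hε
    rw [hκ]
    linarith [h1.2]
  have h7 : (p - q) / ε + 1 ≤ s / κ := (add_one_le_exp _).trans ((le_div_iff₀ hκ0).2 h6)
  have h8 : (p - q) / ε ≤ s / κ := by linarith
  rwa [div_le_iff₀' hε] at h8

/-- If the domain of `φ` stays away from `0`, then `p - aprox p` is bounded below. -/
lemma IsEntropyFunction.le_sub_aprox {φ : ℝ → ℝ≥0∞} (hφ : IsEntropyFunction φ) {ε : ℝ}
    (hε : 0 < ε) {s : ℝ} (hs0 : 0 < s) (hs : ∀ x, x < s → φ x = ⊤) :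
    ∃ B, ∀ p, B ≤ p - aprox φ ε p := by
  set κ := exp 1 - 1 with hκ
  have hκ0 : 0 < κ := by
    have : 1 < exp 1 := one_lt_exp_iff.2 (by norm_num)
    linarith
  refine ⟨ε * log (s / κ), fun p => ?_⟩
  set q := aprox φ ε p with hqd
  have hq : IsProx φ ε p q := hφ.isProx_aprox hε p
  have h1 := hφ.conjR_le (q := q - ε) (b := conjR φ q - ε * s) fun x hx => by
    have h2 := hφ.sub_le_conjR hq.fconj_ne_top hx
    have h3 : s ≤ x := by
      by_contra! h
      exact hx (hs x h)
    nlinarith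
  have h4 := hq.le hφ h1.1
  have h5 : exp ((p - (q - ε)) / ε) = exp ((p - q) / ε) * exp 1 := by
    rw [← exp_add]; congr 1; field_simp; ring
  rw [h5] at h4
  have h6 : s ≤ exp ((p - q) / ε) * κ := by
    refine le_of_mul_le_mul_left ?_ hε
    rw [hκ]
    linarith [h1.2]
  have h7 : log (s / κ) ≤ (p - q) / ε :=
    (log_le_iff_le_exp (by positivity)).2 ((div_le_iff₀ hκ0).2 h6)
  rwa [le_div_iff₀' hε] at h7

/-- The domain of an entropy function is an interval containing `1`. -/
lemma IsEntropyFunction.ne_top_of_mem_uIcc {φ : ℝ → ℝ≥0∞} (hφ : IsEntropyFunction φ) {x y : ℝ}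
    (hx : φ x ≠ ⊤) (hy : y ∈ Set.uIcc 1 x) : φ y ≠ ⊤ := by
  rw [← segment_eq_uIcc] at hy
  obtain ⟨a, b, ha, hb, hab, rfl⟩ := hy
  have h := hφ.convex x 1 b hb (by linarith)
  have e : a • (1 : ℝ) + b • x = b * x + (1 - b) * 1 := by
    simp only [smul_eq_mul]
    linear_combination hab
  rw [e]
  refine (h.trans_lt ?_).ne
  rw [hφ.one_eq_zero, mul_zero, add_zero]
  exact ENNReal.mul_lt_top ENNReal.ofReal_lt_top hx.lt_top

/-- Bound on the sums in a cyclic scheme that replaces the `j`-th entry by `-A j (p n)`, where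
`p n` is close to the sum of the other entries, when `t - A i₀ t` is bounded above for one `i₀`. -/
lemma exists_sum_le_of_cyclic {N : ℕ} (hN : 0 < N) (a : ℕ → Fin N → ℝ) (A : Fin N → ℝ → ℝ)
    (hA : ∀ i, Monotone (A i)) (hR : ∀ i, Monotone fun t => t - A i t) (p : ℕ → ℝ) (K : ℝ)
    (hstep : ∀ n, a (n + 1) = Function.update (a n) ⟨n % N, Nat.mod_lt n hN⟩
      (-A ⟨n % N, Nat.mod_lt n hN⟩ (p n)))
    (hp : ∀ n, |p n - (∑ i, a n i - a n ⟨n % N, Nat.mod_lt n hN⟩)| ≤ K)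
    (i₀ : Fin N) (B : ℝ) (hB : ∀ t, t - A i₀ t ≤ B) : ∃ C, ∀ n, ∑ i, a n i ≤ C := by
  have hsum : ∀ n, ∑ i, a (n + 1) i = ∑ i, a n i - a n ⟨n % N, Nat.mod_lt n hN⟩
      - A ⟨n % N, Nat.mod_lt n hN⟩ (p n) := by
    intro n
    rw [hstep, Finset.sum_update_of_mem (Finset.mem_univ _),
      ← Finset.add_sum_erase _ _ (Finset.mem_univ (⟨n % N, Nat.mod_lt n hN⟩ : Fin N)),
      Finset.sdiff_singleton_eq_erase]
    ring
  have hphase : ∀ k, ∃ C, ∀ n, n % N = (i₀ + k) % N → ∑ i, a (n + 1) i ≤ C := by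
    intro k
    induction k with
    | zero =>
      refine ⟨B + K, fun n hn => ?_⟩
      rw [add_zero, Nat.mod_eq_of_lt i₀.2] at hn
      have hj : (⟨n % N, Nat.mod_lt n hN⟩ : Fin N) = i₀ := Fin.ext hn
      have h1 := hsum n
      have h2 := abs_le.1 (hp n)
      rw [hj] at h1 h2
      linarith [hB (p n), h2.1]
    | succ k ih =>
      obtain ⟨C, hC⟩ := ih
      set j : Fin N := ⟨(i₀ + (k + 1)) % N, Nat.mod_lt _ hN⟩ with hjd
      have hjn : ∀ n, n % N = j → (⟨n % N, Nat.mod_lt n hN⟩ : Fin N) = j := fun n hn => Fin.ext hn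
      set C' := max C (∑ i, a 0 i) with hC'
      have hprev : ∀ n, n % N = j → ∑ i, a n i ≤ C' := by
        intro n hn
        cases n with
        | zero => exact le_max_right _ _
        | succ m =>
          refine (hC m ?_).trans (le_max_left _ _)
          have : m + 1 ≡ i₀ + k + 1 [MOD N] := by
            rw [Nat.ModEq, hn]; rfl
          exact Nat.ModEq.add_right_cancel' 1 this
      set D := max (p j - A j (p j)) (C' + K) with hD
      have hRstep : ∀ n, n % N = j → (∃ q, a n j = -A j q ∧ q - A j q ≤ D) →
          p n - A j (p n) ≤ D := by
        rintro n hn ⟨q, hq, hqD⟩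
        rcases le_total (p n) q with h | h
        · exact (hR j h).trans hqD
        · have h1 := hA j h
          have h2 := abs_le.1 (hp n)
          rw [hjn n hn] at h2
          have h3 := hprev n hn
          refine le_trans ?_ (le_max_right _ _)
          linarith [h2.2]
      have hinv : ∀ n, (j : ℕ) + 1 ≤ n → ∃ q, a n j = -A j q ∧ q - A j q ≤ D := by
        intro n hn
        induction n, hn using Nat.le_induction with
        | base =>
          refine ⟨p j, ?_, le_max_left _ _⟩
          have := hjn j (Nat.mod_eq_of_lt j.2)
          rw [hstep, this, Function.update_self]
        | succ n hn ih =>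
          by_cases h : n % N = j
          · refine ⟨p n, ?_, hRstep n h ih⟩
            rw [hstep, hjn n h, Function.update_self]
          · obtain ⟨q, hq⟩ := ih
            refine ⟨q, ?_⟩
            rwa [hstep, Function.update_of_ne]
            exact fun h' => h (congrArg Fin.val h').symm
      refine ⟨D + K, fun n hn => ?_⟩
      have hn' : n % N = j := hn
      have h1 := hsum n
      have h2 := abs_le.1 (hp n)
      rw [hjn n hn'] at h1 h2
      have h3 : p n - A j (p n) ≤ D := by
        rcases lt_or_ge n ((j : ℕ) + 1) with h | h
        · have : n = j := by
            rw [← hn']; exact (Nat.mod_eq_of_lt (by omega)).symm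
          rw [this]
          exact le_max_left _ _
        · exact hRstep n hn' (hinv n h)
      linarith [h2.1]
  choose C hC using hphase
  refine ⟨max (∑ i, a 0 i) (∑ k ∈ Finset.range N, |C k|), fun n => ?_⟩
  cases n with
  | zero => exact le_max_left _ _
  | succ n =>
    refine le_trans ?_ (le_max_right _ _)
    have hk : ∃ k < N, n % N = (i₀ + k) % N := by
      refine ⟨(n + (N - i₀)) % N, Nat.mod_lt _ hN, ?_⟩
      have := i₀.2
      rw [Nat.add_mod_mod, show (i₀ : ℕ) + (n + (N - i₀)) = n + N by omega, Nat.add_mod_right]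
    obtain ⟨k, hkN, hk⟩ := hk
    calc ∑ i, a (n + 1) i ≤ C k := hC k n hk
      _ ≤ |C k| := le_abs_self _
      _ ≤ _ := Finset.single_le_sum (f := fun k => |C k|) (fun _ _ => abs_nonneg _)
        (Finset.mem_range.2 hkN)

/-- The analogue of `exists_sum_le_of_cyclic` for lower bounds. -/
lemma exists_le_sum_of_cyclic {N : ℕ} (hN : 0 < N) (a : ℕ → Fin N → ℝ) (A : Fin N → ℝ → ℝ)
    (hA : ∀ i, Monotone (A i)) (hR : ∀ i, Monotone fun t => t - A i t) (p : ℕ → ℝ) (K : ℝ)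
    (hstep : ∀ n, a (n + 1) = Function.update (a n) ⟨n % N, Nat.mod_lt n hN⟩
      (-A ⟨n % N, Nat.mod_lt n hN⟩ (p n)))
    (hp : ∀ n, |p n - (∑ i, a n i - a n ⟨n % N, Nat.mod_lt n hN⟩)| ≤ K)
    (i₀ : Fin N) (B : ℝ) (hB : ∀ t, B ≤ t - A i₀ t) : ∃ C, ∀ n, C ≤ ∑ i, a n i := by
  obtain ⟨C, hC⟩ := exists_sum_le_of_cyclic hN (fun n i => -a n i) (fun i t => -A i (-t))
    (fun i x y h => neg_le_neg (hA i (neg_le_neg h)))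
    (fun i x y h => by have := hR i (neg_le_neg h); simp only at this ⊢; linarith)
    (fun n => -p n) K
    (fun n => by
      funext i
      simp only [hstep n, Function.update_apply, neg_neg]
      split_ifs <;> simp)
    (fun n => by
      rw [← abs_neg]
      convert hp n using 2
      simp only [Finset.sum_neg_distrib]
      ring)
    i₀ (-B) (fun t => by linarith [hB (-t)])
  refine ⟨-C, fun n => ?_⟩
  have := hC n
  rw [Finset.sum_neg_distrib] at this
  linarith

lemma integrable_exp_div {Z : Type*} [MeasurableSpace Z] (ν : Measure Z) [IsFiniteMeasure ν]
    {ε : ℝ} (hε : 0 < ε) {h : Z → ℝ} (hm : Measurable h) {b : ℝ} (hb : ∀ z, h z ≤ b) :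
    Integrable (fun z => exp (h z / ε)) ν := by
  refine Integrable.of_bound (C := exp (b / ε)) (by fun_prop) (ae_of_all _ fun z => ?_)
  rw [norm_of_nonneg (exp_pos _).le]
  exact exp_le_exp.2 (by gcongr; exact hb z)

lemma integral_exp_div_pos {Z : Type*} [MeasurableSpace Z] {ν : Measure Z} [IsFiniteMeasure ν]
    (hν : ν ≠ 0) {ε : ℝ} (hε : 0 < ε) {h : Z → ℝ} (hm : Measurable h) {b : ℝ}
    (hb : ∀ z, h z ≤ b) : 0 < ∫ z, exp (h z / ε) ∂ν := by
  have : NeZero ν := ⟨hν⟩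
  exact integral_exp_pos (integrable_exp_div ν hε hm hb)

lemma mul_log_integral_exp_le {Z : Type*} [MeasurableSpace Z] {ν : Measure Z} [IsFiniteMeasure ν]
    (hν : ν ≠ 0) {ε : ℝ} (hε : 0 < ε) {h h' : Z → ℝ} (hm : Measurable h) (hm' : Measurable h')
    {b d : ℝ} (hb : ∀ z, h' z ≤ b) (hd : ∀ z, h z ≤ h' z + d) :
    ε * log (∫ z, exp (h z / ε) ∂ν) ≤ ε * log (∫ z, exp (h' z / ε) ∂ν) + d := by
  have hb' : ∀ z, h z ≤ b + d := fun z => (hd z).trans (by linarith [hb z])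
  have hpos' := integral_exp_div_pos hν hε hm' hb
  have h1 : ∫ z, exp (h z / ε) ∂ν ≤ exp (d / ε) * ∫ z, exp (h' z / ε) ∂ν := by
    rw [← integral_const_mul]
    refine integral_mono (integrable_exp_div ν hε hm hb')
      ((integrable_exp_div ν hε hm' hb).const_mul _) fun z => ?_
    simp only
    rw [← exp_add, ← add_div]
    exact exp_le_exp.2 (by gcongr; linarith [hd z])
  have h2 := log_le_log (integral_exp_div_pos hν hε hm hb') h1
  rw [log_mul (exp_pos _).ne' hpos'.ne', log_exp] at h2
  have h3 := mul_le_mul_of_nonneg_left h2 hε.le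
  have h4 : ε * (d / ε) = d := by field_simp
  linarith

lemma mul_log_integral_exp_const {Z : Type*} [MeasurableSpace Z] {ν : Measure Z}
    [IsFiniteMeasure ν] (hν : ν ≠ 0) {ε : ℝ} (hε : 0 < ε) (b : ℝ) :
    ε * log (∫ _, exp (b / ε) ∂ν) = b + ε * log (ν.real Set.univ) := by
  have : NeZero ν := ⟨hν⟩
  have h0 : ν.real Set.univ ≠ 0 := by
    rw [measureReal_ne_zero_iff]
    exact NeZero.ne _
  rw [integral_const, smul_eq_mul, log_mul h0 (exp_pos _).ne', log_exp]
  field_simp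
  ring

section Product

variable {N : ℕ} {X : Fin N → Type*}

lemma glue_self (j : Fin N) (y : X j) (z : ∀ i : {i : Fin N // i ≠ j}, X i.1) :
    glue j y z j = y := by
  simp [glue]

lemma glue_of_ne (j : Fin N) (y : X j) (z : ∀ i : {i : Fin N // i ≠ j}, X i.1)
    (i : {i : Fin N // i ≠ j}) : glue j y z i.1 = z i := by
  simp [glue, i.2]

lemma fOplus_glue (f : ∀ i, X i → ℝ) (j : Fin N) (y : X j)
    (z : ∀ i : {i : Fin N // i ≠ j}, X i.1) :
    fOplus f (glue j y z) = f j y + ∑ i : {i : Fin N // i ≠ j}, f i.1 (z i) := by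
  unfold fOplus
  rw [Fintype.sum_eq_add_sum_subtype_ne _ j, glue_self]
  simp only [glue_of_ne]

lemma abs_sum_sub_le {f : ∀ i, X i → ℝ} {a : Fin N → ℝ} {B : ℝ} (hB0 : 0 ≤ B)
    (ha : ∀ i x, |f i x - a i| ≤ B) (j : Fin N) (z : ∀ i : {i : Fin N // i ≠ j}, X i.1) :
    |∑ i : {i : Fin N // i ≠ j}, f i.1 (z i) - (∑ i, a i - a j)| ≤ N * B := by
  have : ∑ i, a i - a j = ∑ i : {i : Fin N // i ≠ j}, a i.1 := by
    rw [Fintype.sum_eq_add_sum_subtype_ne a j]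
    ring
  rw [this, ← Finset.sum_sub_distrib]
  refine (Finset.abs_sum_le_sum_abs _ _).trans
    ((Finset.sum_le_card_nsmul _ _ B fun i _ => ha i.1 (z i)).trans ?_)
  rw [nsmul_eq_mul]
  gcongr
  simp

lemma abs_fOplus_sub_le {f : ∀ i, X i → ℝ} {a : Fin N → ℝ} {B : ℝ}
    (ha : ∀ i x, |f i x - a i| ≤ B) (x : ∀ i, X i) :
    |fOplus f x - ∑ i, a i| ≤ N * B := by
  unfold fOplus
  rw [← Finset.sum_sub_distrib]
  refine (Finset.abs_sum_le_sum_abs _ _).trans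
    ((Finset.sum_le_card_nsmul _ _ B fun i _ => ha i (x i)).trans ?_)
  simp

variable [∀ i, MeasurableSpace (X i)]

lemma measurable_glue (j : Fin N) :
    Measurable fun q : X j × (∀ i : {i : Fin N // i ≠ j}, X i.1) => glue j q.1 q.2 := by
  refine measurable_pi_lambda _ fun i => ?_
  by_cases h : i = j
  · subst h
    simpa only [glue_self] using measurable_fst
  · simp only [glue, h, dif_neg, not_false_eq_true]
    exact (measurable_pi_apply _).comp measurable_snd

lemma map_glue (γ : ∀ i, Measure (X i)) [∀ i, IsFiniteMeasure (γ i)] (j : Fin N) :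
    ((γ j).prod (Measure.pi fun i : {i : Fin N // i ≠ j} => γ i.1)).map
      (fun q : X j × (∀ i : {i : Fin N // i ≠ j}, X i.1) => glue j q.1 q.2) = Measure.pi γ := by
  refine (Measure.pi_eq fun s hs => ?_).symm
  rw [Measure.map_apply (measurable_glue j) (MeasurableSet.univ_pi hs)]
  have : (fun q : X j × (∀ i : {i : Fin N // i ≠ j}, X i.1) => glue j q.1 q.2) ⁻¹'
      Set.univ.pi s = s j ×ˢ Set.univ.pi fun i : {i : Fin N // i ≠ j} => s i.1 := by
    ext ⟨y, z⟩
    simp only [Set.mem_preimage, Set.mem_univ_pi, Set.mem_prod]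
    constructor
    · intro h
      refine ⟨by simpa only [glue_self] using h j, fun i => ?_⟩
      simpa only [glue_of_ne] using h i.1
    · rintro ⟨h1, h2⟩ i
      by_cases h : i = j
      · subst h
        simpa only [glue_self] using h1
      · have := glue_of_ne j y z ⟨i, h⟩
        simp only at this
        rw [this]
        exact h2 ⟨i, h⟩
  rw [this, Measure.prod_prod, Measure.pi_pi, Fintype.prod_eq_mul_prod_subtype_ne _ j]

/-- The exponent `Σ_{i≠j} f_i − c` in the `j`-th transform. -/
def partialExponent (c : (∀ i, X i) → ℝ) (f : ∀ i, X i → ℝ) (j : Fin N) (y : X j)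
    (z : ∀ i : {i : Fin N // i ≠ j}, X i.1) : ℝ :=
  (∑ i : {i : Fin N // i ≠ j}, f i.1 (z i)) - c (glue j y z)

/-- The integral inside the logarithm of the `j`-th transform. -/
def partialMarginal (c : (∀ i, X i) → ℝ) (ε : ℝ) (γ : ∀ i, Measure (X i)) (f : ∀ i, X i → ℝ)
    (j : Fin N) (y : X j) : ℝ :=
  ∫ z, exp (partialExponent c f j y z / ε)
    ∂(Measure.pi fun i : {i : Fin N // i ≠ j} => γ i.1)

lemma ctransform_eq (c : (∀ i, X i) → ℝ) (ε : ℝ) (σ : ∀ i, X i → ℝ) (γ : ∀ i, Measure (X i))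
    (f : ∀ i, X i → ℝ) (j : Fin N) (y : X j) :
    ctransform c ε σ γ f j y = ε * log (σ j y) - ε * log (partialMarginal c ε γ f j y) := rfl

lemma partialMarginal_update (c : (∀ i, X i) → ℝ) (ε : ℝ) (γ : ∀ i, Measure (X i))
    (f : ∀ i, X i → ℝ) (j : Fin N) (v : X j → ℝ) (y : X j) :
    partialMarginal c ε γ (Function.update f j v) j y = partialMarginal c ε γ f j y := by
  have : partialExponent c (Function.update f j v) j y = partialExponent c f j y := by
    funext z
    unfold partialExponent
    congr 1
    exact Finset.sum_congr rfl fun i _ => by rw [Function.update_of_ne i.2]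
  unfold partialMarginal
  rw [this]

lemma measurable_uncurry_partialExponent {c : (∀ i, X i) → ℝ} (hc : Measurable c)
    {f : ∀ i, X i → ℝ} (hf : ∀ i, Measurable (f i)) (j : Fin N) :
    Measurable (Function.uncurry (partialExponent c f j)) := by
  refine Measurable.sub (Finset.measurable_sum _ fun i _ => ?_) (hc.comp (measurable_glue j))
  exact (hf i.1).comp ((measurable_pi_apply i).comp measurable_snd)

lemma measurable_partialExponent {c : (∀ i, X i) → ℝ} (hc : Measurable c)
    {f : ∀ i, X i → ℝ} (hf : ∀ i, Measurable (f i)) (j : Fin N) (y : X j) :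
    Measurable (partialExponent c f j y) :=
  (measurable_uncurry_partialExponent hc hf j).comp measurable_prodMk_left

lemma measurable_partialMarginal {c : (∀ i, X i) → ℝ} (hc : Measurable c) (ε : ℝ)
    (γ : ∀ i, Measure (X i)) [∀ i, IsFiniteMeasure (γ i)]
    {f : ∀ i, X i → ℝ} (hf : ∀ i, Measurable (f i)) (j : Fin N) :
    Measurable (partialMarginal c ε γ f j) := by
  have h : Measurable (Function.uncurry fun (y : X j) z =>
      exp (partialExponent c f j y z / ε)) :=
    ((measurable_uncurry_partialExponent hc hf j).div_const ε).exp
  exact h.stronglyMeasurable.integral_prod_right.measurable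

lemma measurable_ctransform {c : (∀ i, X i) → ℝ} (hc : Measurable c) (ε : ℝ)
    {σ : ∀ i, X i → ℝ} (hσ : ∀ i, Measurable (σ i))
    (γ : ∀ i, Measure (X i)) [∀ i, IsFiniteMeasure (γ i)]
    {f : ∀ i, X i → ℝ} (hf : ∀ i, Measurable (f i)) (j : Fin N) :
    Measurable (ctransform c ε σ γ f j) :=
  ((hσ j).log.const_mul ε).sub ((measurable_partialMarginal hc ε γ hf j).log.const_mul ε)

lemma pi_subtype_ne_zero {γ : ∀ i, Measure (X i)} [∀ i, IsFiniteMeasure (γ i)]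
    (hγ : ∀ i, γ i ≠ 0) (j : Fin N) :
    (Measure.pi fun i : {i : Fin N // i ≠ j} => γ i.1) ≠ 0 := by
  intro h
  have h1 : (Measure.pi fun i : {i : Fin N // i ≠ j} => γ i.1) Set.univ = 0 := by rw [h]; rfl
  rw [Measure.pi_univ, Finset.prod_eq_zero_iff] at h1
  obtain ⟨i, -, hi⟩ := h1
  exact hγ i.1 (Measure.measure_univ_eq_zero.1 hi)

variable {c : (∀ i, X i) → ℝ} (hc : Measurable c) {C : ℝ} (hc0 : ∀ x, 0 ≤ c x)
  (hC : ∀ x, c x ≤ C) {ε : ℝ} (hε : 0 < ε) {σ : ∀ i, X i → ℝ}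
  {γ : ∀ i, Measure (X i)} [∀ i, IsFiniteMeasure (γ i)] (hγ : ∀ i, γ i ≠ 0)
  {f : ∀ i, X i → ℝ} (hf : ∀ i, Measurable (f i))
  {a : Fin N → ℝ} {B : ℝ} (hB0 : 0 ≤ B) (ha : ∀ i x, |f i x - a i| ≤ B)

omit [∀ i, MeasurableSpace (X i)] in
include hc0 hB0 ha in
lemma partialExponent_le (j : Fin N) (y : X j) (z : ∀ i : {i : Fin N // i ≠ j}, X i.1) :
    partialExponent c f j y z ≤ (∑ i, a i - a j) + N * B := by
  have h := abs_le.1 (abs_sum_sub_le hB0 ha j z)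
  unfold partialExponent
  linarith [hc0 (glue j y z), h.2]

omit [∀ i, MeasurableSpace (X i)] in
include hC hB0 ha in
lemma le_partialExponent (j : Fin N) (y : X j) (z : ∀ i : {i : Fin N // i ≠ j}, X i.1) :
    (∑ i, a i - a j) - N * B - C ≤ partialExponent c f j y z := by
  have h := abs_le.1 (abs_sum_sub_le hB0 ha j z)
  unfold partialExponent
  linarith [hC (glue j y z), h.1]

include hc hc0 hε hγ hf hB0 ha in
lemma partialMarginal_pos (j : Fin N) (y : X j) : 0 < partialMarginal c ε γ f j y :=
  integral_exp_div_pos (pi_subtype_ne_zero hγ j) hε (measurable_partialExponent hc hf j y)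
    fun z => partialExponent_le hc0 hB0 ha j y z

include hc hc0 hC hε hγ hf hB0 ha in
/-- The transform has oscillation bounded independently of the potentials. -/
lemma ctransform_sub_le {M : ℝ} (j : Fin N) (hM : ∀ x, |log (σ j x)| ≤ M) (y y' : X j) :
    |ctransform c ε σ γ f j y - ctransform c ε σ γ f j y'| ≤ 2 * ε * M + C := by
  have hle : ∀ y y' : X j,
      ctransform c ε σ γ f j y - ctransform c ε σ γ f j y' ≤ 2 * ε * M + C := by
    intro y y'
    have h := mul_log_integral_exp_le (pi_subtype_ne_zero hγ j) hε
      (measurable_partialExponent hc hf j y') (measurable_partialExponent hc hf j y)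
      (d := C) (partialExponent_le hc0 hB0 ha j y) fun z => by
        unfold partialExponent
        linarith [hc0 (glue j y' z), hC (glue j y z)]
    have h1 := mul_le_mul_of_nonneg_left (abs_le.1 (hM y)).2 hε.le
    have h2 := mul_le_mul_of_nonneg_left (abs_le.1 (hM y')).1 hε.le
    rw [ctransform_eq, ctransform_eq]
    unfold partialMarginal
    linarith
  exact abs_le.2 ⟨by linarith [hle y' y], hle y y'⟩

include hc hc0 hC hε hγ hf hB0 ha in
/-- The transform is, up to a controlled error, minus the sum of the sizes of the other
potentials. -/
lemma abs_neg_ctransform_sub_le {M : ℝ} (j : Fin N) (hM : ∀ x, |log (σ j x)| ≤ M) (y : X j) :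
    |-ctransform c ε σ γ f j y - (∑ i, a i - a j)| ≤ ε * M + N * B + C +
      ε * |log ((Measure.pi fun i : {i : Fin N // i ≠ j} => γ i.1).real Set.univ)| := by
  have hν := pi_subtype_ne_zero hγ j
  have hC0 : 0 ≤ C := by
    by_contra! h
    by_cases hX : Nonempty (∀ i, X i)
    · obtain ⟨x⟩ := hX
      linarith [hc0 x, hC x]
    · apply hν
      rw [not_nonempty_iff] at hX
      have : IsEmpty (∀ i : {i : Fin N // i ≠ j}, X i.1) := ⟨fun z => hX.false (glue j y z)⟩
      exact Measure.eq_zero_of_isEmpty _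
  have hNB : 0 ≤ N * B := by positivity
  have h1 := mul_log_integral_exp_le (d := 0) hν hε (measurable_partialExponent hc hf j y)
    measurable_const (fun _ => le_rfl) fun z => by
      rw [add_zero]
      exact partialExponent_le hc0 hB0 ha j y z
  have h2 := mul_log_integral_exp_le (d := 0) hν hε measurable_const
    (measurable_partialExponent hc hf j y) (partialExponent_le hc0 hB0 ha j y) fun z => by
      rw [add_zero]
      exact le_partialExponent hC hB0 ha j y z
  rw [mul_log_integral_exp_const hν hε] at h1 h2
  have h3 := mul_le_mul_of_nonneg_left (abs_le.1 (hM y)).2 hε.le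
  have h4 := mul_le_mul_of_nonneg_left (abs_le.1 (hM y)).1 hε.le
  set l := log ((Measure.pi fun i : {i : Fin N // i ≠ j} => γ i.1).real Set.univ)
  have h5 := mul_le_mul_of_nonneg_left (le_abs_self l) hε.le
  have h6 := mul_le_mul_of_nonneg_left (neg_abs_le l) hε.le
  rw [ctransform_eq]
  unfold partialMarginal
  rw [abs_le]
  constructor <;> linarith

lemma measurable_fOplus (hf : ∀ i, Measurable (f i)) : Measurable (fOplus f) :=
  Finset.measurable_sum _ fun i _ => (hf i).comp (measurable_pi_apply i)

omit [∀ i, MeasurableSpace (X i)] in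
include hc0 ha in
lemma fOplus_sub_le (x : ∀ i, X i) : fOplus f x - c x ≤ ∑ i, a i + N * B := by
  have := abs_le.1 (abs_fOplus_sub_le ha x)
  linarith [hc0 x, this.2]

include hc hc0 hε hf ha in
lemma integral_exp_fOplus_eq (j : Fin N) :
    Integrable (fun y => exp (f j y / ε) * partialMarginal c ε γ f j y) (γ j) ∧
    ∫ x, exp ((fOplus f x - c x) / ε) ∂(Measure.pi γ) =
      ∫ y, exp (f j y / ε) * partialMarginal c ε γ f j y ∂(γ j) := by
  have hint : Integrable (fun x => exp ((fOplus f x - c x) / ε)) (Measure.pi γ) :=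
    integrable_exp_div _ hε ((measurable_fOplus hf).sub hc) (fOplus_sub_le hc0 ha)
  have hpt : ∀ y : X j, ∫ z, exp ((fOplus f (glue j y z) - c (glue j y z)) / ε)
      ∂(Measure.pi fun i : {i : Fin N // i ≠ j} => γ i.1) =
      exp (f j y / ε) * partialMarginal c ε γ f j y := by
    intro y
    unfold partialMarginal
    rw [← integral_const_mul]
    congr 1
    funext z
    rw [← exp_add, fOplus_glue, partialExponent]
    congr 1
    ring
  rw [← map_glue γ j] at hint
  have hint' := (integrable_map_measure hint.aestronglyMeasurable
    (measurable_glue j).aemeasurable).1 hint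
  rw [← map_glue γ j, integral_map (measurable_glue j).aemeasurable hint.aestronglyMeasurable]
  constructor
  · simpa only [Function.comp_apply, hpt] using hint'.integral_prod_left
  · refine (integral_prod _ hint').trans ?_
    simp only [Function.comp_apply, hpt]

/-- The negative of the dual Sinkhorn functional, with densities `exp (log (σ i))`. -/
def energy (c : (∀ i, X i) → ℝ) (ε : ℝ) (σ : ∀ i, X i → ℝ) (γ : ∀ i, Measure (X i))
    (φ : Fin N → ℝ → ℝ≥0∞) (f : ∀ i, X i → ℝ) : ℝ :=
  ∑ i, ∫ x, exp (log (σ i x)) * conjR (φ i) (-f i x) ∂(γ i) +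
    ε * ∫ x, exp ((fOplus f x - c x) / ε) ∂(Measure.pi γ)

/-- The conjugate of `φ` is finite and bounded along `-h`. -/
def ConjBounded {Z : Type*} (φ : ℝ → ℝ≥0∞) (h : Z → ℝ) : Prop :=
  ∃ D, ∀ y, fconj φ (-h y) ≠ ⊤ ∧ |conjR φ (-h y)| ≤ D

lemma integrable_exp_log {Z : Type*} [MeasurableSpace Z] {ν : Measure Z} [IsFiniteMeasure ν]
    {s : Z → ℝ} (hs : Measurable s) {M : ℝ} (hM : ∀ x, |log (s x)| ≤ M) :
    Integrable (fun x => exp (log (s x))) ν := by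
  refine Integrable.of_bound (C := exp M) hs.log.exp.aestronglyMeasurable (ae_of_all _ fun x => ?_)
  rw [norm_of_nonneg (exp_pos _).le]
  exact exp_le_exp.2 (abs_le.1 (hM x)).2

lemma ConjBounded.integrable {Z : Type*} [MeasurableSpace Z] {ν : Measure Z} [IsFiniteMeasure ν]
    {φ : ℝ → ℝ≥0∞} {h : Z → ℝ} (hφh : ConjBounded φ h) (hm : Measurable h)
    {s : Z → ℝ} (hs : Measurable s) {M : ℝ} (hM : ∀ x, |log (s x)| ≤ M) :
    Integrable (fun x => exp (log (s x)) * conjR φ (-h x)) ν := by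
  obtain ⟨D, hD⟩ := hφh
  exact (integrable_exp_log hs hM).mul_bdd (c := D)
    ((measurable_conjR φ).comp hm.neg).aestronglyMeasurable (ae_of_all _ fun x => (hD x).2)

include hc hc0 hε hγ hf hB0 ha in
lemma energy_update_sinkMap_le {φ : Fin N → ℝ → ℝ≥0∞} (hφ : ∀ i, IsEntropyFunction (φ i))
    (hσ : ∀ i, Measurable (σ i)) {M : ℝ} (hM : ∀ i x, |log (σ i x)| ≤ M) (j : Fin N)
    {b : ℝ} (hvm : Measurable (sinkMap c ε σ γ φ f j))
    (hb : ∀ y, |sinkMap c ε σ γ φ f j y - b| ≤ B)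
    (hfj : ConjBounded (φ j) (f j)) (hvj : ConjBounded (φ j) (sinkMap c ε σ γ φ f j)) :
    energy c ε σ γ φ (Function.update f j (sinkMap c ε σ γ φ f j)) ≤ energy c ε σ γ φ f := by
  set v := sinkMap c ε σ γ φ f j with hv
  have hm' : ∀ i, Measurable (Function.update f j v i) := by
    intro i
    by_cases h : i = j
    · subst h
      rwa [Function.update_self]
    · rw [Function.update_of_ne h]
      exact hf i
  have ha' : ∀ i x, |Function.update f j v i x - Function.update a j b i| ≤ B := by
    intro i
    by_cases h : i = j
    · subst h
      simpa only [Function.update_self] using hb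
    · simpa only [Function.update_of_ne h] using ha i
  obtain ⟨hi, he⟩ := integral_exp_fOplus_eq hc hc0 hε (γ := γ) hf ha j
  obtain ⟨hi', he'⟩ := integral_exp_fOplus_eq hc hc0 hε (γ := γ) hm' ha' j
  simp only [partialMarginal_update, Function.update_self] at hi' he'
  unfold energy
  rw [he, he', Fintype.sum_eq_add_sum_subtype_ne _ j,
    Fintype.sum_eq_add_sum_subtype_ne
      (fun i => ∫ x, exp (log (σ i x)) * conjR (φ i) (-f i x) ∂(γ i)) j]
  have hrest : ∑ i : {i : Fin N // i ≠ j}, ∫ x, exp (log (σ i x)) *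
      conjR (φ i) (-Function.update f j v i x) ∂(γ i) =
      ∑ i : {i : Fin N // i ≠ j}, ∫ x, exp (log (σ i x)) * conjR (φ i) (-f i x) ∂(γ i) :=
    Finset.sum_congr rfl fun i _ => by rw [Function.update_of_ne i.2]
  rw [hrest, Function.update_self]
  have hI := hfj.integrable (ν := γ j) (hf j) (hσ j) (hM j)
  have hI' := hvj.integrable (ν := γ j) hvm (hσ j) (hM j)
  have key : ∫ x, exp (log (σ j x)) * conjR (φ j) (-v x) +
      ε * (exp (v x / ε) * partialMarginal c ε γ f j x) ∂(γ j) ≤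
      ∫ x, exp (log (σ j x)) * conjR (φ j) (-f j x) +
      ε * (exp (f j x / ε) * partialMarginal c ε γ f j x) ∂(γ j) := by
    refine integral_mono (hI'.add (hi'.const_mul ε)) (hI.add (hi.const_mul ε)) fun y => ?_
    have hpos := partialMarginal_pos hc hc0 hε hγ hf hB0 ha j y
    have hexp : ∀ t, exp (log (σ j y)) * exp ((-ctransform c ε σ γ f j y - -t) / ε) =
        exp (t / ε) * partialMarginal c ε γ f j y := by
      intro t
      rw [← exp_add]
      conv_rhs => rw [← exp_log hpos, ← exp_add]
      rw [ctransform_eq]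
      congr 1
      field_simp
      ring
    obtain ⟨D, hD⟩ := hfj
    have hprox := ((hφ j).isProx_aprox hε (-ctransform c ε σ γ f j y)).le (hφ j) (hD y).1
    have hvy : aprox (φ j) ε (-ctransform c ε σ γ f j y) = -v y := by
      rw [hv, sinkMap, neg_neg]
    rw [hvy] at hprox
    have := mul_le_mul_of_nonneg_left hprox (exp_pos (log (σ j y))).le
    simp only
    rw [← hexp, ← hexp]
    linarith
  rw [integral_add hI' (hi'.const_mul ε), integral_add hI (hi.const_mul ε), integral_const_mul,
    integral_const_mul] at key
  linarith

include hc hc0 hC hε hf ha in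
lemma le_energy {φ : Fin N → ℝ → ℝ≥0∞} (hφ : ∀ i, IsEntropyFunction (φ i))
    (hσ : ∀ i, Measurable (σ i)) {M : ℝ} (hM : ∀ i x, |log (σ i x)| ≤ M)
    (hfc : ∀ i, ConjBounded (φ i) (f i)) {s : Fin N → ℝ} {m : ℝ} (hs0 : ∀ i, 0 ≤ s i)
    (hs : ∀ i, φ i (s i) ≠ ⊤) (hsm : ∀ i, s i * ∫ x, exp (log (σ i x)) ∂(γ i) = m) :
    -m * ∑ i, a i - ∑ i, (m * B + (∫ x, exp (log (σ i x)) ∂(γ i)) * (φ i (s i)).toReal) +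
      ε * ((Measure.pi γ).real Set.univ * exp (-(N * B + C) / ε)) * exp ((∑ i, a i) / ε)
      ≤ energy c ε σ γ φ f := by
  unfold energy
  have h1 : ∀ i, -m * a i - (m * B + (∫ x, exp (log (σ i x)) ∂(γ i)) * (φ i (s i)).toReal) ≤
      ∫ x, exp (log (σ i x)) * conjR (φ i) (-f i x) ∂(γ i) := by
    intro i
    have hint : Integrable (fun x => exp (log (σ i x))) (γ i) := integrable_exp_log (hσ i) (hM i)
    calc -m * a i - (m * B + (∫ x, exp (log (σ i x)) ∂(γ i)) * (φ i (s i)).toReal)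
        = ∫ x, exp (log (σ i x)) * (-(a i + B) * s i - (φ i (s i)).toReal) ∂(γ i) := by
          rw [integral_mul_const, ← hsm i]
          ring
      _ ≤ _ := by
          refine integral_mono (hint.mul_const _)
            ((hfc i).integrable (hf i) (hσ i) (hM i)) fun x => ?_
          refine mul_le_mul_of_nonneg_left ?_ (exp_pos _).le
          obtain ⟨D, hD⟩ := hfc i
          have h2 := (hφ i).sub_le_conjR (hD x).1 (hs i)
          have h3 := (abs_le.1 (ha i x)).2
          nlinarith [hs0 i]
  have h2 : (Measure.pi γ).real Set.univ * exp (-(N * B + C) / ε) * exp ((∑ i, a i) / ε) ≤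
      ∫ x, exp ((fOplus f x - c x) / ε) ∂(Measure.pi γ) := by
    rw [mul_assoc, ← exp_add, ← smul_eq_mul, ← integral_const]
    refine integral_mono (integrable_const _)
      (integrable_exp_div _ hε ((measurable_fOplus hf).sub hc) (fOplus_sub_le hc0 ha)) fun x => ?_
    refine exp_le_exp.2 ?_
    rw [← add_div]
    have := (abs_le.1 (abs_fOplus_sub_le ha x)).1
    gcongr
    linarith [hC x]
  have h3 := Finset.sum_le_sum fun i (_ : i ∈ Finset.univ) => h1 i
  rw [Finset.sum_sub_distrib, ← Finset.mul_sum] at h3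
  have h4 := mul_le_mul_of_nonneg_left h2 hε.le
  linarith

end Product

lemma exists_abs_le_of_exp_sub_linear_le {m κ ε : ℝ} (hm : 0 < m) (hκ : 0 < κ) (hε : 0 < ε)
    (D E : ℝ) : ∃ R, ∀ S, -m * S - D + κ * exp (S / ε) ≤ E → |S| ≤ R := by
  set κ' := κ / (2 * ε ^ 2) with hκ'
  have hκ'0 : 0 < κ' := by positivity
  refine ⟨1 + |E + D| / m + (m + |E + D|) / κ', fun S hS => ?_⟩
  have h1 : 0 ≤ |E + D| / m := by positivity
  have h2 : 0 ≤ (m + |E + D|) / κ' := by positivity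
  have h3 := le_abs_self (E + D)
  rw [abs_le]
  constructor
  · have h4 : -S ≤ |E + D| / m := by
      rw [le_div_iff₀ hm]
      have : 0 < κ * exp (S / ε) := by positivity
      linarith
    linarith
  · rcases le_total S 1 with h | h
    · linarith
    · have h4 := quadratic_le_exp_of_nonneg (x := S / ε) (by positivity)
      have h5 : κ' * S ^ 2 ≤ κ * exp (S / ε) := by
        have : κ' * S ^ 2 = κ * ((S / ε) ^ 2 / 2) := by rw [hκ']; field_simp
        rw [this]
        have : 0 ≤ S / ε := by positivity
        gcongr
        linarith
      have h6 : S ≤ (m + |E + D|) / κ' := by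
        rw [le_div_iff₀ hκ'0]
        nlinarith [abs_nonneg (E + D)]
      linarith

section Iterates

variable {N : ℕ} {X : Fin N → Type*} [∀ i, MeasurableSpace (X i)]
  {c : (∀ i, X i) → ℝ} (hc : Measurable c) {C : ℝ} (hc0 : ∀ x, 0 ≤ c x) (hC : ∀ x, c x ≤ C)
  {ε : ℝ} (hε : 0 < ε) {σ : ∀ i, X i → ℝ} (hσ : ∀ i, Measurable (σ i))
  {M : ℝ} (hM : ∀ i x, |log (σ i x)| ≤ M)
  {γ : ∀ i, Measure (X i)} [∀ i, IsFiniteMeasure (γ i)] (hγ : ∀ i, γ i ≠ 0)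
  {φ : Fin N → ℝ → ℝ≥0∞} (hφ : ∀ i, IsEntropyFunction (φ i))

section Step

variable {f : ∀ i, X i → ℝ} (hf : ∀ i, Measurable (f i))

include hc hε hσ hφ hf in
lemma measurable_sinkMap (j : Fin N) : Measurable (sinkMap c ε σ γ φ f j) :=
  (((hφ j).aprox_mono hε).measurable.comp (measurable_ctransform hc ε hσ γ hf j).neg).neg

variable {a : Fin N → ℝ} {B : ℝ} (hB0 : 0 ≤ B) (ha : ∀ i x, |f i x - a i| ≤ B)

include hc hc0 hC hε hM hγ hφ hf hB0 ha

lemma sinkMap_sub_le (j : Fin N) (y y' : X j) :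
    |sinkMap c ε σ γ φ f j y - sinkMap c ε σ γ φ f j y'| ≤ 2 * ε * M + C := by
  have h1 := (hφ j).abs_aprox_sub_le hε (-ctransform c ε σ γ f j y') (-ctransform c ε σ γ f j y)
  have h2 := ctransform_sub_le hc hc0 hC hε hγ hf hB0 ha j (hM j) y y'
  unfold sinkMap
  rw [show ∀ u v : ℝ, -u - -v = v - u by intros; ring] at h1 ⊢
  exact h1.trans h2

lemma conjBounded_sinkMap (j : Fin N) : ConjBounded (φ j) (sinkMap c ε σ γ φ f j) := by
  set K := ε * M + N * B + C +
    ε * |log ((Measure.pi fun i : {i : Fin N // i ≠ j} => γ i.1).real Set.univ)|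
  refine ⟨max (ε * exp ((∑ i, a i - a j + K) / ε)) (-aprox (φ j) ε (∑ i, a i - a j - K)),
    fun y => ?_⟩
  have hp := abs_le.1 (abs_neg_ctransform_sub_le hc hc0 hC hε hγ hf hB0 ha j (hM j) y)
  have hprox := (hφ j).isProx_aprox hε (-ctransform c ε σ γ f j y)
  rw [sinkMap, neg_neg]
  refine ⟨hprox.fconj_ne_top, abs_le.2 ⟨?_, ?_⟩⟩
  · have h1 := (hφ j).sub_le_conjR (x := 1) hprox.fconj_ne_top
      (by simp [(hφ j).one_eq_zero])
    have h2 := (hφ j).aprox_mono hε (show ∑ i, a i - a j - K ≤ -ctransform c ε σ γ f j y by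
      linarith [hp.1])
    rw [(hφ j).one_eq_zero, ENNReal.toReal_zero] at h1
    have h3 := le_max_right (ε * exp ((∑ i, a i - a j + K) / ε))
      (-aprox (φ j) ε (∑ i, a i - a j - K))
    linarith
  · refine (hprox.conjR_le (hφ j) hε).trans (le_trans ?_ (le_max_left _ _))
    gcongr
    linarith [hp.2]

end Step

variable (hN : 0 < N) {fs : ℕ → ∀ i, X i → ℝ}
  (hiter : ∀ n : ℕ, fs (n + 1) = Function.update (fs n) ⟨n % N, Nat.mod_lt n hN⟩
    (sinkMap c ε σ γ φ (fs n) ⟨n % N, Nat.mod_lt n hN⟩))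

include hc hc0 hC hε hσ hM hγ hφ hiter in
/-- Measurability and uniform oscillation bounds propagate along the iterates. -/
lemma iterates_measurable_osc [∀ i, Nonempty (X i)] (hf0 : ∀ i, Measurable (fs 0 i)) {B : ℝ}
    (hB0 : 0 ≤ B) (hB : 2 * ε * M + C ≤ B) (hosc : ∀ i x x', |fs 0 i x - fs 0 i x'| ≤ B) (n : ℕ) :
    (∀ i, Measurable (fs n i)) ∧ ∀ i x x', |fs n i x - fs n i x'| ≤ B := by
  induction n with
  | zero => exact ⟨hf0, hosc⟩
  | succ n ih =>
    rw [hiter n]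
    set j : Fin N := ⟨n % N, Nat.mod_lt n hN⟩
    refine ⟨fun i => ?_, fun i => ?_⟩ <;> by_cases h : i = j
    · subst h
      rw [Function.update_self]
      exact measurable_sinkMap hc hε hσ hφ ih.1 _
    · rw [Function.update_of_ne h]
      exact ih.1 i
    · subst h
      rw [Function.update_self]
      exact fun x x' => (sinkMap_sub_le hc hc0 hC hε hM hγ hφ ih.1 hB0
        (fun i x => ih.2 i x (Classical.arbitrary _)) _ x x').trans hB
    · rw [Function.update_of_ne h]
      exact ih.2 i

variable {B : ℝ} (hB0 : 0 ≤ B) (hfs : ∀ n i, Measurable (fs n i))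
  (hosc : ∀ n i x x', |fs n i x - fs n i x'| ≤ B) (x₀ : ∀ i, X i)

include hc hc0 hC hε hσ hM hγ hφ hiter hB0 hfs hosc

/-- If some multiples of the marginals have equal mass and finite entropy, the dual energy
controls the sums of the iterates. -/
lemma exists_abs_sum_le_of_energy {s : Fin N → ℝ} {m : ℝ} (hm : 0 < m) (hs0 : ∀ i, 0 ≤ s i)
    (hs : ∀ i, φ i (s i) ≠ ⊤) (hsm : ∀ i, s i * ∫ x, exp (log (σ i x)) ∂(γ i) = m) :
    ∃ R, ∀ n, |∑ i, fs n i (x₀ i)| ≤ R := by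
  have hcb : ∀ n, ∀ i : Fin N, i.1 < n → ConjBounded (φ i) (fs n i) := by
    intro n
    induction n with
    | zero => exact fun i hi => absurd hi (Nat.not_lt_zero _)
    | succ n ih =>
      intro i hi
      rw [hiter n]
      by_cases h : i = ⟨n % N, Nat.mod_lt n hN⟩
      · subst h
        rw [Function.update_self]
        exact conjBounded_sinkMap hc hc0 hC hε hM hγ hφ (hfs n) hB0
          (fun i x => hosc n i x (x₀ i)) _
      · rw [Function.update_of_ne h]
        refine ih i (lt_of_le_of_ne (Nat.lt_succ_iff.1 hi) fun hin => h (Fin.ext ?_))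
        simp only [← hin, Nat.mod_eq_of_lt i.2]
  have hcb' : ∀ n, N ≤ n → ∀ i, ConjBounded (φ i) (fs n i) :=
    fun n hn i => hcb n i (i.2.trans_le hn)
  have hdec : ∀ n, N ≤ n → energy c ε σ γ φ (fs n) ≤ energy c ε σ γ φ (fs N) := by
    intro n hn
    induction n, hn using Nat.le_induction with
    | base => exact le_rfl
    | succ n hn ih =>
      refine le_trans ?_ ih
      set j : Fin N := ⟨n % N, Nat.mod_lt n hN⟩
      have hv : fs (n + 1) j = sinkMap c ε σ γ φ (fs n) j := by
        rw [hiter n, Function.update_self]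
      rw [hiter n]
      exact energy_update_sinkMap_le hc hc0 hε hγ (hfs n) hB0 (fun i x => hosc n i x (x₀ i)) hφ
        hσ hM j (hv ▸ hfs (n + 1) j) (b := fs (n + 1) j (x₀ j))
        (fun y => hv ▸ hosc (n + 1) j y (x₀ j)) (hcb' n hn j)
        (hv ▸ hcb' (n + 1) (hn.trans n.le_succ) j)
  have hpi : 0 < (Measure.pi γ).real Set.univ := by
    rw [Measure.real, Measure.pi_univ, ENNReal.toReal_prod]
    exact Finset.prod_pos fun i _ => by
      have : NeZero (γ i) := ⟨hγ i⟩
      exact measureReal_univ_pos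
  obtain ⟨R, hR⟩ := exists_abs_le_of_exp_sub_linear_le hm
    (mul_pos hε (mul_pos hpi (exp_pos (-(N * B + C) / ε)))) hε
    (∑ i, (m * B + (∫ x, exp (log (σ i x)) ∂(γ i)) * (φ i (s i)).toReal))
    (energy c ε σ γ φ (fs N))
  refine ⟨|R| + ∑ k ∈ Finset.range N, |∑ i, fs k i (x₀ i)|, fun n => ?_⟩
  rcases lt_or_ge n N with hn | hn
  · have := Finset.single_le_sum (f := fun k => |∑ i, fs k i (x₀ i)|)
      (fun k _ => abs_nonneg _) (Finset.mem_range.2 hn)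
    linarith [abs_nonneg R]
  · have h1 := hR _ ((le_energy hc hc0 hC hε (hfs n) (fun i x => hosc n i x (x₀ i)) hφ hσ hM
      (hcb' n hn) hs0 hs hsm).trans (hdec n hn))
    have h2 : 0 ≤ ∑ k ∈ Finset.range N, |∑ i, fs k i (x₀ i)| :=
      Finset.sum_nonneg fun k _ => abs_nonneg _
    linarith [le_abs_self R]

/-- The sums of the iterates at a base point stay bounded. -/
lemma exists_abs_sum_le : ∃ R, ∀ n, |∑ i, fs n i (x₀ i)| ≤ R := by
  set W : Fin N → ℝ := fun i => ∫ x, exp (log (σ i x)) ∂(γ i)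
  have hW0 : ∀ i, 0 < W i := fun i => by
    have : NeZero (γ i) := ⟨hγ i⟩
    exact integral_exp_pos (integrable_exp_log (hσ i) (hM i))
  have : Nonempty (Fin N) := ⟨⟨0, hN⟩⟩
  have hWm : ∀ i, ∀ m, m / W i * W i = m := fun i m => div_mul_cancel₀ m (hW0 i).ne'
  by_cases hup : ∀ i s, ∃ x, s < x ∧ φ i x ≠ ⊤
  · obtain ⟨k, hk⟩ := Finite.exists_max W
    have h1 : ∀ i, 1 ≤ W k / W i := fun i => (one_le_div (hW0 i)).2 (hk i)
    refine exists_abs_sum_le_of_energy hc hc0 hC hε hσ hM hγ hφ hN hiter hB0 hfs hosc x₀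
      (s := fun i => W k / W i) (hW0 k) (fun i => zero_le_one.trans (h1 i)) (fun i => ?_)
      fun i => hWm i _
    obtain ⟨x, hx, hxt⟩ := hup i (W k / W i)
    exact (hφ i).ne_top_of_mem_uIcc hxt (Set.mem_uIcc.2 (Or.inl ⟨h1 i, hx.le⟩))
  by_cases hdown : ∀ i s, 0 < s → ∃ x, x < s ∧ φ i x ≠ ⊤
  · obtain ⟨k, hk⟩ := Finite.exists_min W
    have h0 : ∀ i, 0 < W k / W i := fun i => div_pos (hW0 k) (hW0 i)
    refine exists_abs_sum_le_of_energy hc hc0 hC hε hσ hM hγ hφ hN hiter hB0 hfs hosc x₀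
      (s := fun i => W k / W i) (hW0 k) (fun i => (h0 i).le) (fun i => ?_) fun i => hWm i _
    obtain ⟨x, hx, hxt⟩ := hdown i _ (h0 i)
    exact (hφ i).ne_top_of_mem_uIcc hxt
      (Set.mem_uIcc.2 (Or.inr ⟨hx.le, (div_le_one (hW0 i)).2 (hk i)⟩))
  push Not at hup hdown
  obtain ⟨i, s, hs⟩ := hup
  obtain ⟨k, t, ht0, ht⟩ := hdown
  set L : Fin N → ℝ := fun j =>
    |log ((Measure.pi fun i : {i : Fin N // i ≠ j} => γ i.1).real Set.univ)|
  set K := ε * M + N * B + C + ε * ∑ j, L j with hK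
  set a : ℕ → Fin N → ℝ := fun n i => fs n i (x₀ i) with ha
  set p : ℕ → ℝ := fun n => -ctransform c ε σ γ (fs n) ⟨n % N, Nat.mod_lt n hN⟩ (x₀ _) with hp
  have hstep : ∀ n, a (n + 1) = Function.update (a n) ⟨n % N, Nat.mod_lt n hN⟩
      (-aprox (φ ⟨n % N, Nat.mod_lt n hN⟩) ε (p n)) := by
    intro n
    funext i
    simp only [ha, hiter n]
    by_cases h : i = ⟨n % N, Nat.mod_lt n hN⟩
    · subst h
      simp only [Function.update_self, sinkMap, hp]
    · simp only [Function.update_of_ne h]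
  have hpK : ∀ n, |p n - (∑ i, a n i - a n ⟨n % N, Nat.mod_lt n hN⟩)| ≤ K := by
    intro n
    refine (abs_neg_ctransform_sub_le hc hc0 hC hε hγ (hfs n) hB0
      (fun i x => hosc n i x (x₀ i)) _ (hM _) _).trans ?_
    have := Finset.single_le_sum (f := L) (fun j _ => abs_nonneg _)
      (Finset.mem_univ (⟨n % N, Nat.mod_lt n hN⟩ : Fin N))
    simp only [hK]
    gcongr
  obtain ⟨b, hb⟩ := (hφ i).sub_aprox_le hε hs
  obtain ⟨b', hb'⟩ := (hφ k).le_sub_aprox hε ht0 ht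
  obtain ⟨R, hR⟩ := exists_sum_le_of_cyclic hN a (fun i => aprox (φ i) ε)
    (fun i => (hφ i).aprox_mono hε) (fun i => (hφ i).sub_aprox_mono hε) p K hstep hpK i b hb
  obtain ⟨R', hR'⟩ := exists_le_sum_of_cyclic hN a (fun i => aprox (φ i) ε)
    (fun i => (hφ i).aprox_mono hε) (fun i => (hφ i).sub_aprox_mono hε) p K hstep hpK k b' hb'
  exact ⟨max R (-R'), fun n => abs_le.2
    ⟨by linarith [hR' n, le_max_right R (-R')], (hR n).trans (le_max_left _ _)⟩⟩

end Iterates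

/-- If one of the reference measures vanishes, the transforms in the other variables reduce to
the logarithms of the densities. -/
lemma ctransform_eq_of_measure_eq_zero {N : ℕ} {X : Fin N → Type*} [∀ i, MeasurableSpace (X i)]
    (c : (∀ i, X i) → ℝ) (ε : ℝ) (σ : ∀ i, X i → ℝ) {γ : ∀ i, Measure (X i)}
    [∀ i, IsFiniteMeasure (γ i)] (f : ∀ i, X i → ℝ) {j k : Fin N} (hk : γ k = 0) (hkj : k ≠ j)
    (y : X j) : ctransform c ε σ γ f j y = ε * log (σ j y) := by
  have h : (Measure.pi fun i : {i : Fin N // i ≠ j} => γ i.1) = 0 := by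
    rw [← Measure.measure_univ_eq_zero, Measure.pi_univ]
    exact Finset.prod_eq_zero (Finset.mem_univ ⟨k, hkj⟩) (by rw [hk]; rfl)
  rw [ctransform, h, integral_zero_measure, Real.log_zero, mul_zero, sub_zero]

lemma essSup_ofReal_abs_lt {Z : Type*} [MeasurableSpace Z] {ν : Measure Z} {h : Z → ℝ} {R : ℝ}
    (hR : 0 ≤ R) (hh : ν ≠ 0 → ∀ x, |h x| ≤ R) :
    essSup (fun x => ENNReal.ofReal |h x|) ν < ENNReal.ofReal (R + 1) := by
  have hlt : ENNReal.ofReal R < ENNReal.ofReal (R + 1) :=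
    (ENNReal.ofReal_lt_ofReal_iff (by linarith)).2 (by linarith)
  refine lt_of_le_of_lt (essSup_le_of_ae_le _ ?_) hlt
  by_cases hν : ν = 0
  · subst hν
    rw [ae_zero]
    exact eventually_bot
  · exact ae_of_all _ fun x => ENNReal.ofReal_le_ofReal (hh hν x)

/-- Lemma 4.6: for the sequence of cyclic Sinkhorn iterates there are
recentering constants `λ^{(n)}` summing to zero such that the recentered iterates are
uniformly bounded in `L^∞`. -/
theorem sinkhorn_iterates_bounded
    {N : ℕ} (hN : 0 < N) {X : Fin N → Type*}
    [∀ i, TopologicalSpace (X i)] [∀ i, PolishSpace (X i)] [∀ i, CompactSpace (X i)]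
    [∀ i, Nonempty (X i)] [∀ i, MeasurableSpace (X i)] [∀ i, BorelSpace (X i)]
    (γ : ∀ i, Measure (X i)) [∀ i, IsFiniteMeasure (γ i)]
    (μ : ∀ i, Measure (X i)) [∀ i, IsFiniteMeasure (μ i)]
    (σ : ∀ i, X i → ℝ) (hσm : ∀ i, Measurable (σ i))
    (hσd : ∀ i, μ i = (γ i).withDensity (fun x => ENNReal.ofReal (σ i x)))
    (hσb : ∀ i, ∃ M : ℝ, ∀ x, |Real.log (σ i x)| ≤ M)
    (c : (∀ i, X i) → ℝ) (hc : Continuous c) (hc0 : ∀ x, 0 ≤ c x)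
    (ε : ℝ) (hε : 0 < ε)
    (φ : Fin N → ℝ → ℝ≥0∞) (hφ : ∀ i, IsEntropyFunction (φ i))
    -- the Sinkhorn iterates: start in `L^{∞,×}(X)` and cyclically update one component
    (fs : ℕ → ∀ i, X i → ℝ) (hf0 : BddMeasTuple (fs 0))
    (hiter : ∀ n : ℕ, fs (n + 1) =
      Function.update (fs n) ⟨n % N, Nat.mod_lt n hN⟩
        (sinkMap c ε σ γ φ (fs n) ⟨n % N, Nat.mod_lt n hN⟩)) :
    ∃ (lam : ℕ → Fin N → ℝ) (M : ℝ), 0 < M ∧ (∀ n, ∑ i, lam n i = 0) ∧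
      ∀ n i, essSup (fun x => (ENNReal.ofReal |fs n i x + lam n i|)) (γ i)
        < ENNReal.ofReal M := by
  choose m hm using hσb
  choose hf0m m₀ hm₀ using hf0
  set M := ∑ i, |m i|
  set M₀ := ∑ i, |m₀ i|
  have hM₀ : 0 ≤ M₀ := Finset.sum_nonneg fun i _ => abs_nonneg _
  have hM0 : 0 ≤ M := Finset.sum_nonneg fun i _ => abs_nonneg _
  have hM : ∀ i x, |Real.log (σ i x)| ≤ M := fun i x => (hm i x).trans <| (le_abs_self _).trans <|
    Finset.single_le_sum (f := fun i => |m i|) (fun i _ => abs_nonneg _) (Finset.mem_univ i)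
  have hfM₀ : ∀ i x, |fs 0 i x| ≤ M₀ := fun i x => (hm₀ i x).trans <| (le_abs_self _).trans <|
    Finset.single_le_sum (f := fun i => |m₀ i|) (fun i _ => abs_nonneg _) (Finset.mem_univ i)
  by_cases hγ : ∀ i, γ i ≠ 0
  · obtain ⟨C, hC⟩ := isCompact_univ.bddAbove_image hc.continuousOn
    replace hC : ∀ x, c x ≤ C := fun x => hC ⟨x, Set.mem_univ x, rfl⟩
    have x₀ : ∀ i, X i := fun i => Classical.arbitrary _
    have hC0 : 0 ≤ C := (hc0 x₀).trans (hC x₀)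
    set B := 2 * M₀ + (2 * ε * M + C) with hB
    have hB' : 2 * ε * M + C ≤ B := by linarith
    have hB0 : 0 ≤ B := by positivity
    have hinv := iterates_measurable_osc hc.measurable hc0 hC hε hσm hM hγ hφ hN hiter hf0m hB0
      hB' fun i x x' => by
        have h1 : 0 ≤ 2 * ε * M + C := by positivity
        linarith [abs_sub (fs 0 i x) (fs 0 i x'), hfM₀ i x, hfM₀ i x']
    obtain ⟨R, hR⟩ := exists_abs_sum_le hc.measurable hc0 hC hε hσm hM hγ hφ hN hiter hB0
      (fun n => (hinv n).1) (fun n => (hinv n).2) x₀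
    have hR0 : 0 ≤ R := (abs_nonneg _).trans (hR 0)
    have hN1 : (1 : ℝ) ≤ N := by exact_mod_cast hN
    refine ⟨fun n i => -fs n i (x₀ i) + (∑ k, fs n k (x₀ k)) / N, B + R + 1, by linarith,
      fun n => ?_, fun n i => essSup_ofReal_abs_lt (add_nonneg hB0 hR0) fun _ x => ?_⟩
    · rw [Finset.sum_add_distrib, Finset.sum_neg_distrib, Finset.sum_const, Finset.card_univ,
        Fintype.card_fin, nsmul_eq_mul]
      field_simp
      ring
    · have h1 : |(∑ k, fs n k (x₀ k)) / N| ≤ R := by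
        rw [abs_div, Nat.abs_cast]
        exact (div_le_self (abs_nonneg _) hN1).trans (hR n)
      rw [← add_assoc, ← sub_eq_add_neg]
      exact (abs_add_le _ _).trans (add_le_add ((hinv n).2 i x (x₀ i)) h1)
  · push Not at hγ
    obtain ⟨k, hk⟩ := hγ
    set P := ∑ i, |aprox (φ i) ε 0|
    have hP0 : 0 ≤ P := Finset.sum_nonneg fun i _ => abs_nonneg _
    have hεM : 0 ≤ ε * M := by positivity
    have hbound : ∀ n i, γ i ≠ 0 → ∀ x, |fs n i x| ≤ M₀ + P + ε * M := by
      intro n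
      induction n with
      | zero => exact fun i _ x => (hfM₀ i x).trans (by linarith)
      | succ n ih =>
        intro i hi x
        rw [hiter n]
        by_cases h : i = ⟨n % N, Nat.mod_lt n hN⟩
        · subst h
          rw [Function.update_self, sinkMap, abs_neg,
            ctransform_eq_of_measure_eq_zero c ε σ (fs n) hk (by rintro rfl; exact hi hk)]
          have h1 := (hφ ⟨n % N, Nat.mod_lt n hN⟩).abs_aprox_sub_le hε
            (-(ε * Real.log (σ ⟨n % N, Nat.mod_lt n hN⟩ x))) 0
          rw [sub_zero, abs_neg, abs_mul, abs_of_pos hε] at h1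
          have h2 := mul_le_mul_of_nonneg_left (hM ⟨n % N, Nat.mod_lt n hN⟩ x) hε.le
          have h3 : |aprox (φ ⟨n % N, Nat.mod_lt n hN⟩) ε 0| ≤ P :=
            Finset.single_le_sum (f := fun i => |aprox (φ i) ε 0|) (fun i _ => abs_nonneg _)
              (Finset.mem_univ (⟨n % N, Nat.mod_lt n hN⟩ : Fin N))
          have h4 := abs_sub_abs_le_abs_sub
            (aprox (φ ⟨n % N, Nat.mod_lt n hN⟩) ε
              (-(ε * Real.log (σ ⟨n % N, Nat.mod_lt n hN⟩ x))))
            (aprox (φ ⟨n % N, Nat.mod_lt n hN⟩) ε 0)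
          linarith
        · rw [Function.update_of_ne h]
          exact ih i hi x
    exact ⟨fun _ _ => 0, M₀ + P + ε * M + 1, by positivity, fun n => Finset.sum_const_zero,
      fun n i => essSup_ofReal_abs_lt (by positivity) fun hi x => by
        rw [add_zero]
        exact hbound n i hi x⟩

end UMOT
end
end

section
/- Let G = (V,E) be a tree with N nodes, X_i finite sets of sizes M_i, and a cost tensor c decoupling along the tree: c = ⊕_{(j,k)∈E} c^{(j,k)} with c^{(j,k)} ∈ ℝ_{≥0}^{M_j×M_k}. Set K = exp(−c/ε) = ⊗_{(j,k)∈E} K^{(j,k)} with K^{(j,k)} = exp(−c^{(j,k)}/ε). For positive vectors u_i ∈ ℝ_+^{M_i} and u = u_1⊗···⊗u_N, the projection onto the j-th marginal satisfies P_{X_j}#(K ⊙ u) = u_j ⊙ ⊙_{l∈N_j} α_{(j,l)}, where N_j is the set of neighbors of j in G and the vectors α are defined recursively from the leaves by α_{(j,k)} = K^{(j,k)} ( u_k ⊙ ⊙_{l∈N_k∖{j}} α_{(k,l)} ), with the convention that an empty product equals the all-ones vector. -/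
open Finset

noncomputable section
namespace UMOT

/-- Summing over a box whose `l`-th side is full amounts to summing over the box whose `l`-th side
is a point, and then over the `l`-th coordinate. -/
theorem sum_piFinset_eq_sum_sum_update {V R : Type*} [Fintype V] [DecidableEq V]
    [AddCommMonoid R] {X : V → Type*} [∀ i, Fintype (X i)]
    {s t : ∀ i, Finset (X i)} (l : V) (a : X l) (hs : s l = univ) (ht : t l = {a})
    (hst : ∀ i, i ≠ l → s i = t i) (f : (∀ i, X i) → R) :
    ∑ x ∈ Fintype.piFinset s, f x
      = ∑ x ∈ Fintype.piFinset t, ∑ z : X l, f (Function.update x l z) := by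
  rw [← Finset.sum_product']
  refine Finset.sum_nbij' (fun x => (Function.update x l a, x l))
    (fun p => Function.update p.1 l p.2) ?_ ?_ ?_ ?_ ?_
  · intro x hx
    simp only [mem_product, Fintype.mem_piFinset, mem_univ, and_true] at hx ⊢
    intro i
    rcases eq_or_ne i l with rfl | h
    · simp [ht]
    · simpa [h, ← hst i h] using hx i
  · rintro ⟨x, z⟩ hx
    simp only [mem_product, Fintype.mem_piFinset, mem_univ, and_true] at hx ⊢
    intro i
    rcases eq_or_ne i l with rfl | h
    · simp [hs]
    · simpa [h, hst i h] using hx i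
  · intro x _
    simp
  · rintro ⟨x, z⟩ hx
    simp only [mem_product, Fintype.mem_piFinset, mem_univ, and_true] at hx
    have h := hx l
    rw [ht, mem_singleton] at h
    simp [← h]
  · intro x _
    simp

/-- In an acyclic graph, a vertex outside a set that is connected to a root by walks inside the
set has at most one neighbour in the set. -/
theorem eq_of_adj_of_isAcyclic {V : Type*} {G : SimpleGraph V} (hG : G.IsAcyclic) {S : Set V}
    {r : V} (hS : ∀ a ∈ S, ∃ p : G.Walk r a, ∀ v ∈ p.support, v ∈ S) {i k l : V}
    (hi : i ∈ S) (hk : k ∈ S) (hl : l ∉ S) (hil : G.Adj i l) (hkl : G.Adj k l) : i = k := by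
  classical
  by_contra hik
  obtain ⟨p, hp⟩ := hS i hi
  obtain ⟨q, hq⟩ := hS k hk
  let w : G.Walk i k := p.reverse.append q
  have hw : ∀ v ∈ w.support, v ∈ S := by
    intro v hv
    rw [SimpleGraph.Walk.mem_support_append_iff, SimpleGraph.Walk.support_reverse,
      List.mem_reverse] at hv
    exact hv.elim (hp v) (hq v)
  let w' : G.Walk i k := .cons hil (.cons hkl.symm .nil)
  have hw' : w'.IsPath := by
    simp [w', SimpleGraph.Walk.cons_isPath_iff, hil.ne, hkl.ne', hik]
  have h : w.toPath = ⟨w', hw'⟩ := (hG.subsingleton_path i k).elim _ _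
  have hmem : l ∈ (w.toPath : G.Walk i k).support := by
    rw [h]
    simp [w']
  exact hl (hw l (w.support_toPath_subset_support hmem))

section MessagePassing

variable {V R : Type*} [Fintype V] [LinearOrder V] [CommSemiring R] {X : V → Type*}
  (G : SimpleGraph V) [DecidableRel G.Adj] (K : ∀ j k : V, X j → X k → R)
  (u : ∀ i, X i → R) (α : ∀ j _ : V, X j → R)

/-- The edges of `G` inside `S`, each written as an increasing pair. -/
def edgesIn (S : Finset V) : Finset (V × V) :=
  {p | (p.1 < p.2 ∧ G.Adj p.1 p.2) ∧ p.1 ∈ S ∧ p.2 ∈ S}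

/-- The weight of `x` on the subgraph induced by `S`, the messages `α` entering `S` from outside
being included. -/
def weightOn (S : Finset V) (x : ∀ i, X i) : R :=
  (∏ p ∈ edgesIn G S, K p.1 p.2 (x p.1) (x p.2))
    * ∏ i ∈ S, (u i (x i) * ∏ l ∈ G.neighborFinset i \ S, α i l (x i))

variable {G K} in
theorem prod_edgesIn_insert (hK : ∀ j k x y, K j k x y = K k j y x) {S : Finset V} {i l : V}
    (hi : i ∈ S) (hl : l ∉ S) (hil : G.Adj i l) (huniq : ∀ k ∈ S, G.Adj k l → k = i)
    (x : ∀ i, X i) :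
    ∏ p ∈ edgesIn G (insert l S), K p.1 p.2 (x p.1) (x p.2)
      = K i l (x i) (x l) * ∏ p ∈ edgesIn G S, K p.1 p.2 (x p.1) (x p.2) := by
  have key : ∀ e : V × V, (e = (i, l) ∨ e = (l, i)) → e.1 < e.2 →
      edgesIn G (insert l S) = insert e (edgesIn G S) ∧ e ∉ edgesIn G S := by
    intro e he hlt
    constructor
    · ext ⟨a, b⟩
      have h1 := huniq a
      have h2 := huniq b
      have h3 := hil.symm
      have h4 : G.Adj a b → G.Adj b a := fun h => h.symm
      simp only [edgesIn, mem_filter, mem_univ, true_and, mem_insert]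
      grind
    · rcases he with rfl | rfl <;> simp [edgesIn, hl]
  rcases lt_or_gt_of_ne hil.ne with h | h
  · obtain ⟨h1, h2⟩ := key (i, l) (Or.inl rfl) h
    rw [h1, prod_insert h2]
  · obtain ⟨h1, h2⟩ := key (l, i) (Or.inr rfl) h
    rw [h1, prod_insert h2, hK l i]

variable [∀ i, Fintype (X i)]

/-- The total weight on `S`, the coordinates at `j` and outside `S` being those of `x₀`. -/
def rootedMarginal (j : V) (x₀ : ∀ i, X i) (S : Finset V) : R :=
  ∑ x ∈ Fintype.piFinset fun i => if i ∈ S ∧ i ≠ j then univ else {x₀ i}, weightOn G K u α S x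

variable {G K u α}

/-- Absorbing the message from `l` to `i` into the weight. -/
theorem weightOn_eq_sum_update (hK : ∀ j k x y, K j k x y = K k j y x)
    (hα : ∀ j k, G.Adj j k → ∀ y : X j,
      α j k y = ∑ z : X k, K j k y z * (u k z * ∏ l ∈ (G.neighborFinset k).erase j, α k l z))
    {S : Finset V} {i l : V} (hi : i ∈ S) (hl : l ∉ S) (hil : G.Adj i l)
    (huniq : ∀ k ∈ S, G.Adj k l → k = i) (x : ∀ i, X i) :
    weightOn G K u α S x
      = ∑ z : X l, weightOn G K u α (insert l S) (Function.update x l z) := by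
  have hne : ∀ k ∈ S, k ≠ l := fun k hk h => hl (h ▸ hk)
  have hvert : ∏ k ∈ S, (u k (x k) * ∏ m ∈ G.neighborFinset k \ S, α k m (x k))
      = α i l (x i) *
        ∏ k ∈ S, (u k (x k) * ∏ m ∈ G.neighborFinset k \ insert l S, α k m (x k)) := by
    rw [← mul_prod_erase S _ hi, ← mul_prod_erase S _ hi]
    have h1 : G.neighborFinset i \ S = insert l (G.neighborFinset i \ insert l S) := by
      ext m
      simp only [mem_sdiff, mem_insert, SimpleGraph.mem_neighborFinset]
      grind
    have h2 : ∀ k ∈ S.erase i, G.neighborFinset k \ S = G.neighborFinset k \ insert l S := by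
      intro k hk
      have := huniq k
      ext m
      simp only [mem_sdiff, mem_insert, SimpleGraph.mem_neighborFinset]
      grind
    have h3 : ∏ k ∈ S.erase i, (u k (x k) * ∏ m ∈ G.neighborFinset k \ S, α k m (x k))
        = ∏ k ∈ S.erase i, (u k (x k) * ∏ m ∈ G.neighborFinset k \ insert l S, α k m (x k)) :=
      prod_congr rfl fun k hk => by rw [h2 k hk]
    rw [h1, prod_insert (by simp), h3]
    ring
  have hl' : G.neighborFinset l \ insert l S = (G.neighborFinset l).erase i := by
    ext m
    have := huniq m
    have h4 : G.Adj l m → G.Adj m l := fun h => h.symm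
    have h5 : ¬ G.Adj l l := G.irrefl
    simp only [mem_sdiff, mem_insert, SimpleGraph.mem_neighborFinset, mem_erase]
    grind
  rw [weightOn, hvert, hα i l hil, sum_mul, mul_sum]
  refine sum_congr rfl fun z _ => ?_
  rw [weightOn, prod_edgesIn_insert hK hi hl hil huniq, prod_insert hl, hl',
    Function.update_self, Function.update_of_ne hil.ne]
  have hE : ∏ p ∈ edgesIn G S, K p.1 p.2 (Function.update x l z p.1) (Function.update x l z p.2)
      = ∏ p ∈ edgesIn G S, K p.1 p.2 (x p.1) (x p.2) := by
    refine prod_congr rfl fun p hp => ?_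
    simp only [edgesIn, mem_filter] at hp
    rw [Function.update_of_ne (hne _ hp.2.2.1), Function.update_of_ne (hne _ hp.2.2.2)]
  have hV : ∏ k ∈ S, (u k (Function.update x l z k)
        * ∏ m ∈ G.neighborFinset k \ insert l S, α k m (Function.update x l z k))
      = ∏ k ∈ S, (u k (x k) * ∏ m ∈ G.neighborFinset k \ insert l S, α k m (x k)) :=
    prod_congr rfl fun k hk => by rw [Function.update_of_ne (hne k hk)]
  rw [hE, hV]
  ring

theorem rootedMarginal_eq_univ (hG : G.IsTree) (hK : ∀ j k x y, K j k x y = K k j y x)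
    (hα : ∀ j k, G.Adj j k → ∀ y : X j,
      α j k y = ∑ z : X k, K j k y z * (u k z * ∏ l ∈ (G.neighborFinset k).erase j, α k l z))
    (j : V) (x₀ : ∀ i, X i) (S : Finset V) (hj : j ∈ S)
    (hS : ∀ a ∈ S, ∃ p : G.Walk j a, ∀ v ∈ p.support, v ∈ S) :
    rootedMarginal G K u α j x₀ S = rootedMarginal G K u α j x₀ univ := by
  by_cases hu : S = univ
  · rw [hu]
  obtain ⟨b, hb⟩ : ∃ b, b ∉ S := by
    by_contra! h
    exact hu (eq_univ_iff_forall.2 h)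
  obtain ⟨p⟩ := hG.connected.preconnected j b
  obtain ⟨d, -, hi, hl⟩ := p.exists_boundary_dart (S : Set V) hj hb
  have hil := d.adj
  generalize d.fst = i at hi hil
  generalize d.snd = l at hl hil
  rw [mem_coe] at hi hl
  have huniq : ∀ k ∈ S, G.Adj k l → k = i := fun k hk hkl =>
    eq_of_adj_of_isAcyclic (S := (S : Set V)) hG.isAcyclic hS hk hi hl hkl hil
  have hlj : l ≠ j := fun h => hl (h ▸ hj)
  have hstep : rootedMarginal G K u α j x₀ S = rootedMarginal G K u α j x₀ (insert l S) := by
    unfold rootedMarginal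
    rw [sum_piFinset_eq_sum_sum_update l (x₀ l)
      (s := fun i => if i ∈ insert l S ∧ i ≠ j then univ else {x₀ i})
      (t := fun i => if i ∈ S ∧ i ≠ j then univ else {x₀ i})
      (by simp [hlj]) (by simp [hl]) (fun k hk => by simp [hk])]
    exact sum_congr rfl fun x _ => weightOn_eq_sum_update hK hα hi hl hil huniq x
  rw [hstep]
  refine rootedMarginal_eq_univ hG hK hα j x₀ (insert l S) (mem_insert_of_mem hj) ?_
  intro a ha
  rcases mem_insert.1 ha with rfl | ha
  · obtain ⟨q, hq⟩ := hS i hi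
    refine ⟨q.concat hil, fun v hv => ?_⟩
    rw [SimpleGraph.Walk.support_concat, List.mem_append, List.mem_singleton] at hv
    rcases hv with hv | rfl
    · exact mem_insert_of_mem (hq v hv)
    · exact mem_insert_self _ _
  · obtain ⟨q, hq⟩ := hS a ha
    exact ⟨q, fun v hv => mem_insert_of_mem (hq v hv)⟩
termination_by Sᶜ.card
decreasing_by
  exact card_lt_card (compl_ssubset_compl.2 (ssubset_insert hl))

/-- A message along the first edge of a path leading to a vertex with empty state space is zero. -/
theorem message_eq_zero_of_isPath
    (hα : ∀ j k, G.Adj j k → ∀ y : X j,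
      α j k y = ∑ z : X k, K j k y z * (u k z * ∏ l ∈ (G.neighborFinset k).erase j, α k l z))
    {j k b : V} (hjk : G.Adj j k) (q : G.Walk k b) (hb : IsEmpty (X b))
    (hq : (SimpleGraph.Walk.cons hjk q).IsPath) (y : X j) : α j k y = 0 := by
  induction q generalizing j with
  | nil => rw [hα j _ hjk, univ_eq_empty, sum_empty]
  | @cons k m b hkm r ih =>
    rw [hα j k hjk]
    refine sum_eq_zero fun z _ => ?_
    have hjm : m ≠ j := by
      rintro rfl
      rw [SimpleGraph.Walk.cons_isPath_iff] at hq
      exact hq.2 (by simp)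
    rw [prod_eq_zero (i := m) (by simpa [hjm] using hkm) (ih hkm hb hq.of_cons z), mul_zero,
      mul_zero]

theorem sum_ite_eq_mul_prod_messages [∀ i, DecidableEq (X i)] (hG : G.IsTree)
    (hK : ∀ j k x y, K j k x y = K k j y x)
    (hα : ∀ j k, G.Adj j k → ∀ y : X j,
      α j k y = ∑ z : X k, K j k y z * (u k z * ∏ l ∈ (G.neighborFinset k).erase j, α k l z))
    (j : V) (y : X j) :
    (∑ x : ∀ i, X i, if x j = y then
        (∏ p : V × V, if p.1 < p.2 ∧ G.Adj p.1 p.2 then K p.1 p.2 (x p.1) (x p.2) else 1)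
          * ∏ i, u i (x i)
      else 0)
    = u j y * ∏ l ∈ G.neighborFinset j, α j l y := by
  by_cases hX : ∃ b, IsEmpty (X b)
  · obtain ⟨b, hb⟩ := hX
    have : IsEmpty (∀ i, X i) := ⟨fun x => hb.elim (x b)⟩
    rw [univ_eq_empty, sum_empty]
    obtain ⟨p, hp⟩ := (hG.connected.preconnected j b).exists_isPath
    cases p with
    | nil => exact hb.elim y
    | @cons _ k _ hjk q =>
      rw [prod_eq_zero (i := k) (by simpa using hjk) (message_eq_zero_of_isPath hα hjk q hb hp y),
        mul_zero]
  simp only [not_exists, not_isEmpty_iff] at hX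
  let x₀ : ∀ i, X i := Function.update (fun i => (hX i).some) j y
  have hx₀ : x₀ j = y := Function.update_self ..
  have h := rootedMarginal_eq_univ hG hK hα j x₀ {j} (mem_singleton_self j) (by
    intro a ha
    obtain rfl := mem_singleton.1 ha
    exact ⟨.nil, by simp⟩)
  have h1 : rootedMarginal G K u α j x₀ {j} = u j y * ∏ l ∈ G.neighborFinset j, α j l y := by
    have hbox : (Fintype.piFinset fun i => if i ∈ ({j} : Finset V) ∧ i ≠ j then univ else {x₀ i})
        = {x₀} := by
      rw [← Fintype.piFinset_singleton]
      congr 1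
      funext i
      simp
    have hedges : edgesIn G {j} = ∅ := by
      ext ⟨a, b⟩
      simp only [edgesIn, mem_filter, mem_univ, true_and, mem_singleton, notMem_empty, iff_false]
      rintro ⟨⟨hab, -⟩, rfl, rfl⟩
      exact lt_irrefl _ hab
    have hnbr : G.neighborFinset j \ {j} = G.neighborFinset j :=
      sdiff_eq_self_of_disjoint (by simp)
    rw [rootedMarginal, hbox, sum_singleton, weightOn, hedges, prod_empty, one_mul,
      prod_singleton, hnbr, hx₀]
  rw [← h1, h, rootedMarginal, ← sum_filter]
  refine sum_congr ?_ fun x _ => ?_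
  · ext x
    simp only [mem_filter, mem_univ, true_and, Fintype.mem_piFinset]
    constructor
    · intro hx i
      rcases eq_or_ne i j with rfl | hi
      · simp [hx, hx₀]
      · simp [hi]
    · intro hx
      simpa [hx₀] using hx j
  · simp [weightOn, edgesIn, prod_filter, sdiff_eq_empty_iff_subset.2 (subset_univ _)]

end MessagePassing

/-- Theorem 5.6: for a cost tensor decoupling along a tree
`G = (V,E)`, `c = ⊕_{(j,k)∈E} c^{(j,k)}`, set `K = exp(−c/ε) = ⊗_{(j,k)∈E} K^{(j,k)}`.
If the vectors `α_{(j,k)}` satisfy the recursion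
`α_{(j,k)} = K^{(j,k)} (u_k ⊙ ⊙_{l∈N_k∖{j}} α_{(k,l)})` (which determines them from the
leaves, the empty product being `1`), then the `j`-th marginal of `K ⊙ (u_1⊗···⊗u_N)` is
`u_j ⊙ ⊙_{l∈N_j} α_{(j,l)}`. -/
theorem tree_marginal_formula
    {N : ℕ} {X : Fin N → Type*} [∀ i, Fintype (X i)] [∀ i, DecidableEq (X i)]
    (G : SimpleGraph (Fin N)) [DecidableRel G.Adj] (hG : G.IsTree)
    (c : ∀ j k : Fin N, X j → X k → ℝ)
    (hcs : ∀ j k x y, c j k x y = c k j y x) (hc0 : ∀ j k x y, 0 ≤ c j k x y)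
    (ε : ℝ) (hε : 0 < ε)
    (u : ∀ i, X i → ℝ) (hu : ∀ i x, 0 < u i x)
    (α : ∀ j k : Fin N, X j → ℝ)
    -- the recursion `α_{(j,k)} = K^{(j,k)} (u_k ⊙ ⊙_{l ∈ N_k∖{j}} α_{(k,l)})`
    (hα : ∀ j k : Fin N, G.Adj j k → ∀ y : X j,
      α j k y = ∑ z : X k, Real.exp (-(c j k y z) / ε)
        * (u k z * ∏ l ∈ (G.neighborFinset k).erase j, α k l z))
    (j : Fin N) (y : X j) :
    -- `P_{X_j}#(K ⊙ u) = u_j ⊙ ⊙_{l∈N_j} α_{(j,l)}`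
    (∑ x : ∀ i, X i, if x j = y then
        (∏ p : Fin N × Fin N, if p.1 < p.2 ∧ G.Adj p.1 p.2 then
            Real.exp (-(c p.1 p.2 (x p.1) (x p.2)) / ε) else 1)
          * ∏ i, u i (x i)
      else 0)
    = u j y * ∏ l ∈ G.neighborFinset j, α j l y := by
  exact sum_ite_eq_mul_prod_messages (K := fun j k y z => Real.exp (-(c j k y z) / ε)) hG
    (fun j k x y => by simp only [hcs j k]) hα j y

end UMOT
end
end
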